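/- arXiv:1609.01635 — 11 statements merged into one kernel-verified Lean document; each statement's English description precedes it below -/
import Mathlib

section
/- Let n ≥ 2. For every X ∈ Sp(2n,ℂ) one has a_{-n,…,-3,-2,2}(X) = −a_{-n,…,-3,-1,1}(X); that is, the determinant of the n×n submatrix of X formed by the top n rows (rows -n,…,-1) and the columns -n,…,-3,-2,2 equals the negative of the determinant of the n×n submatrix formed by the same rows and the columns -n,…,-3,-1,1. -/
open Matrix

noncomputable section

/-- Sign of the position `p` in the ordered index set `I_n = {-n,…,-1,1,…,n}`:
positions `0,…,n-1` correspond to the negative indices `-n,…,-1` (sign `-1`),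
positions `n,…,2n-1` correspond to the positive indices `1,…,n` (sign `1`). -/
def sgn (n : ℕ) (p : Fin (2*n)) : ℂ := if (p : ℕ) < n then -1 else 1

/-- The matrix `J` with `J_{k,-k} = sign k` and all other entries `0`.
The index `-k` of `k` corresponds to position reversal `Fin.rev`. -/
def Jmat (n : ℕ) : Matrix (Fin (2*n)) (Fin (2*n)) ℂ :=
  Matrix.of fun p q => if q = p.rev then sgn n p else 0

/-- The complex symplectic group `Sp(2n,ℂ) = {X : Xᵀ J X = J}`. -/
def Sp (n : ℕ) : Set (Matrix (Fin (2*n)) (Fin (2*n)) ℂ) :=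
  {X | Xᵀ * Jmat n * X = Jmat n}

/-- The bilinear map obtained from an alternating map by freeing the arguments `a ≠ b`. -/
def AlternatingMap.bilinOfUpdate {R M N ι : Type*} [CommRing R] [AddCommGroup M] [Module R M]
    [AddCommGroup N] [Module R N] [DecidableEq ι] (f : M [⋀^ι]→ₗ[R] N) (w : ι → M) {a b : ι}
    (hab : a ≠ b) : M →ₗ[R] M →ₗ[R] N :=
  LinearMap.mk₂ R (fun u v => f (Function.update (Function.update w a u) b v))
    (fun u u' v => by simp only [Function.update_comm hab, f.map_update_add])
    (fun c u v => by simp only [Function.update_comm hab, f.map_update_smul])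
    (fun u v v' => f.map_update_add _ _ _ _)
    (fun c u v => f.map_update_smul _ _ _ _)

theorem AlternatingMap.bilinOfUpdate_apply {R M N ι : Type*} [CommRing R] [AddCommGroup M]
    [Module R M] [AddCommGroup N] [Module R N] [DecidableEq ι] (f : M [⋀^ι]→ₗ[R] N)
    (w : ι → M) {a b : ι} (hab : a ≠ b) (u v : M) :
    f.bilinOfUpdate w hab u v = f (Function.update (Function.update w a u) b v) :=
  rfl

theorem AlternatingMap.bilinOfUpdate_self {R M N ι : Type*} [CommRing R] [AddCommGroup M]
    [Module R M] [AddCommGroup N] [Module R N] [DecidableEq ι] (f : M [⋀^ι]→ₗ[R] N)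
    (w : ι → M) {a b : ι} (hab : a ≠ b) (u : M) : f.bilinOfUpdate w hab u u = 0 :=
  f.map_eq_zero_of_eq _ (by simp [hab]) hab

theorem AlternatingMap.bilinOfUpdate_apply_left {R M N ι : Type*} [CommRing R] [AddCommGroup M]
    [Module R M] [AddCommGroup N] [Module R N] [DecidableEq ι] (f : M [⋀^ι]→ₗ[R] N)
    (w : ι → M) {a b : ι} (hab : a ≠ b) {s : ι} (hsa : s ≠ a) (hsb : s ≠ b) (v : M) :
    f.bilinOfUpdate w hab (w s) v = 0 :=
  f.map_eq_zero_of_eq _ (by simp [hab, hsa, hsb]) hsa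

theorem AlternatingMap.bilinOfUpdate_swap {R M N ι : Type*} [CommRing R] [AddCommGroup M]
    [Module R M] [AddCommGroup N] [Module R N] [DecidableEq ι] (f : M [⋀^ι]→ₗ[R] N)
    (w : ι → M) {a b : ι} (hab : a ≠ b) (u v : M) :
    f.bilinOfUpdate w hab u v = -f.bilinOfUpdate w hab v u :=
  (LinearMap.IsAlt.neg (B := f.bilinOfUpdate w hab) (f.bilinOfUpdate_self w hab) v u).symm

/-- A bilinear map kills every tensor `∑ c p • u p ⊗ v p` whose coordinates vanish. -/
theorem LinearMap.sum_smul_apply_eq_zero {R N κ P : Type*} [CommRing R] [AddCommGroup N]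
    [Module R N] [Fintype κ] [DecidableEq κ] [Fintype P] (B : (κ → R) →ₗ[R] (κ → R) →ₗ[R] N)
    (c : P → R) (u v : P → κ → R) (h : ∀ i j, ∑ p, c p * u p i * v p j = 0) :
    ∑ p, c p • B (u p) (v p) = 0 := by
  have expand (x y : κ → R) :
      B x y = ∑ i, ∑ j, (x i * y j) • B (Pi.single i 1) (Pi.single j 1) := by
    have basis (z : κ → R) : z = ∑ i, z i • Pi.single i 1 := by
      simp [← Pi.single_smul, Finset.univ_sum_single]
    conv_lhs => rw [basis x, basis y]
    simp only [map_sum, map_smul, LinearMap.sum_apply, LinearMap.smul_apply, Finset.smul_sum,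
      smul_smul]
    refine Finset.sum_comm.trans <| Finset.sum_congr rfl fun i _ => ?_
    exact Finset.sum_congr rfl fun j _ => by rw [mul_comm]
  simp_rw [fun p => expand (u p) (v p), Finset.smul_sum, smul_smul]
  rw [Finset.sum_comm]
  refine Finset.sum_eq_zero fun i _ => ?_
  rw [Finset.sum_comm]
  refine Finset.sum_eq_zero fun j _ => ?_
  rw [← Finset.sum_smul]
  simp_rw [← mul_assoc, h, zero_smul]

theorem Jmat_mul_self (n : ℕ) : Jmat n * Jmat n = -1 := by
  ext p q
  have hsgn : sgn n p * sgn n p.rev = -1 := by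
    unfold sgn
    rw [Fin.val_rev]
    split_ifs <;> first | omega | norm_num
  rw [Matrix.mul_apply, Finset.sum_eq_single p.rev]
  · by_cases h : p = q
    · subst h
      simp [Jmat, hsgn]
    · simp [Jmat, h, Ne.symm h]
  · intro j _ hj
    simp [Jmat, hj]
  · simp

theorem mul_Jmat_mul_transpose {n : ℕ} {X : Matrix (Fin (2*n)) (Fin (2*n)) ℂ} (hX : X ∈ Sp n) :
    X * Jmat n * Xᵀ = Jmat n := by
  have hX' : Xᵀ * Jmat n * X = Jmat n := hX
  have left : -(Jmat n * Xᵀ * Jmat n) * X = 1 := by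
    rw [neg_mul, Matrix.mul_assoc (Jmat n), Matrix.mul_assoc (Jmat n), hX', Jmat_mul_self, neg_neg]
  have right := mul_eq_one_comm.mp left
  calc X * Jmat n * Xᵀ = X * -(Jmat n * Xᵀ * Jmat n) * Jmat n := by
        simp only [Matrix.mul_neg, Matrix.neg_mul, Matrix.mul_assoc, Jmat_mul_self,
          Matrix.mul_one, neg_neg]
    _ = Jmat n := by rw [right, Matrix.one_mul]

/-- The rows of a symplectic matrix pair under `J` as the standard basis vectors do. -/
theorem sum_sgn_mul_apply_mul_apply_rev {n : ℕ} {X : Matrix (Fin (2*n)) (Fin (2*n)) ℂ}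
    (hX : X ∈ Sp n) (i j : Fin (2*n)) :
    ∑ p, sgn n p * X i p * X j p.rev = Jmat n i j := by
  rw [← mul_Jmat_mul_transpose hX, Matrix.mul_assoc, Matrix.mul_apply]
  refine Finset.sum_congr rfl fun p _ => ?_
  simp [Matrix.mul_apply, Jmat]
  ring

/-- For `X ∈ Sp(2n,ℂ)`, `a_{-n,…,-3,-2,2}(X) = - a_{-n,…,-3,-1,1}(X)`:
minors over the top `n` rows, with columns `-n,…,-3,-2,2`
(positions `0,…,n-2` and `n+1`) resp. columns `-n,…,-3,-1,1`
(positions `0,…,n-3`, `n-1` and `n`). -/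
theorem statement0 (n : ℕ) (hn : 2 ≤ n) (X : Matrix (Fin (2*n)) (Fin (2*n)) ℂ)
    (hX : X ∈ Sp n) :
    (X.submatrix (fun s : Fin n => (⟨(s : ℕ), by have := s.isLt; omega⟩ : Fin (2*n)))
        (fun s : Fin n =>
          if (s : ℕ) < n - 1 then (⟨(s : ℕ), by have := s.isLt; omega⟩ : Fin (2*n))
          else ⟨n + 1, by omega⟩)).det
      = - (X.submatrix (fun s : Fin n => (⟨(s : ℕ), by have := s.isLt; omega⟩ : Fin (2*n)))
        (fun s : Fin n =>
          if (s : ℕ) < n - 2 then (⟨(s : ℕ), by have := s.isLt; omega⟩ : Fin (2*n))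
          else if (s : ℕ) = n - 2 then (⟨n - 1, by omega⟩ : Fin (2*n))
          else ⟨n, by omega⟩)).det := by
  obtain ⟨m, rfl⟩ := Nat.exists_eq_add_of_le' hn
  set r : Fin (m + 2) → Fin (2 * (m + 2)) := fun s => ⟨s, by omega⟩ with hr
  set col : Fin (2 * (m + 2)) → Fin (m + 2) → ℂ := fun p i => X (r i) p with hcol
  set a : Fin (m + 2) := ⟨m, by omega⟩ with ha
  set b : Fin (m + 2) := ⟨m + 1, by omega⟩ with hb
  have hab : a ≠ b := by simp [ha, hb]
  set B := (detRowAlternating (R := ℂ) (n := Fin (m + 2))).bilinOfUpdate (fun s => col (r s)) hab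
    with hB
  have hsum : ∑ p, sgn (m + 2) p • B (col p) (col p.rev) = 0 := by
    refine B.sum_smul_apply_eq_zero _ _ _ fun i j => ?_
    rw [sum_sgn_mul_apply_mul_apply_rev hX, Jmat, of_apply, if_neg]
    simp only [hr, Fin.ext_iff, Fin.val_rev]
    omega
  have hleft (p : Fin (2 * (m + 2))) (hp : (p : ℕ) < m) (v : Fin (m + 2) → ℂ) :
      B (col p) v = 0 :=
    AlternatingMap.bilinOfUpdate_apply_left _ _ hab (s := ⟨p, by omega⟩)
      (by simp only [ha, ne_eq, Fin.ext_iff]; omega)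
      (by simp only [hb, ne_eq, Fin.ext_iff]; omega) v
  have hswap (u v : Fin (m + 2) → ℂ) : B u v = -B v u :=
    AlternatingMap.bilinOfUpdate_swap _ _ hab u v
  let q (k : ℕ) (hk : k < 4) : Fin (2 * (m + 2)) := ⟨m + k, by omega⟩
  have hfour : ∑ p, sgn (m + 2) p • B (col p) (col p.rev) =
      ∑ k : Fin 4, sgn (m + 2) (q k k.2) • B (col (q k k.2)) (col (q k k.2).rev) := by
    symm
    refine Finset.sum_of_injOn (fun k : Fin 4 => q k k.2) ?_ (by simp) ?_ (fun _ _ => rfl)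
    · intro k _ l _ h
      simpa [q, Fin.ext_iff] using h
    · intro p _ hp
      have hp' : (p : ℕ) < m ∨ (p.rev : ℕ) < m := by
        by_contra! h
        rw [Fin.val_rev] at h
        refine hp ⟨⟨p - m, by omega⟩, by simp, Fin.ext ?_⟩
        simp only [q]
        omega
      rcases hp' with h | h
      · rw [hleft p h, smul_zero]
      · rw [hswap, hleft _ h, neg_zero, smul_zero]
  have hrev (k : ℕ) (hk : k < 4) : (q k hk).rev = q (3 - k) (by omega) := by
    ext
    simp only [q, Fin.val_rev]
    omega
  have key : B (col (q 0 (by omega))) (col (q 3 (by omega))) =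
      -B (col (q 1 (by omega))) (col (q 2 (by omega))) := by
    rw [hsum, Fin.sum_univ_four] at hfour
    simp only [hrev] at hfour
    simp [sgn, q] at hfour
    have h₁ := hswap (col (q 2 (by omega))) (col (q 1 (by omega)))
    have h₂ := hswap (col (q 3 (by omega))) (col (q 0 (by omega)))
    simp only [q] at h₁ h₂ ⊢
    linear_combination (1 / 2) * hfour + (1 / 2) * h₁ + (1 / 2) * h₂
  have hdet (c : Fin (m + 2) → Fin (2 * (m + 2)))
      (hc : ∀ s : Fin (m + 2), (s : ℕ) < m → c s = r s) :
      (X.submatrix r c).det = B (col (c a)) (col (c b)) := by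
    rw [← det_transpose, hB, AlternatingMap.bilinOfUpdate_apply]
    change det _ = det _
    congr 1
    ext s i
    rcases eq_or_ne s b with rfl | hsb
    · simp [hcol]
    rcases eq_or_ne s a with rfl | hsa
    · simp [hcol, hsb]
    have hs : (s : ℕ) < m := by
      simp only [ha, hb, ne_eq, Fin.ext_iff] at hsa hsb
      omega
    simp [hcol, hsa, hsb, hc s hs]
  rw [hdet _ fun s hs => if_pos (by omega), hdet _ fun s hs => if_pos (by omega)]
  simpa [ha, hb, q] using key
end
end

section
/- Let n ≥ 1. For every X ∈ O(2n+1,ℂ) one has a_{-n,…,-2,1}(X) · a_{-n,…,-2,-1}(X) = −(1/2) · a_{-n,…,-2,0}(X)²; that is, with minors taken over the top n rows (rows -n,…,-1), the determinant on columns -n,…,-2,1 times the determinant on columns -n,…,-2,-1 equals minus one half of the square of the determinant on columns -n,…,-2,0. -/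
open Matrix

noncomputable section

/-- The matrix `S` of size `(2n+1) × (2n+1)` with `S_{k,-k} = 1` and all other
entries `0`; rows and columns are indexed by `{-n,…,-1,0,1,…,n}` via positions
`0,…,2n`, and `-k` corresponds to position reversal `Fin.rev`. -/
def SmatOdd (n : ℕ) : Matrix (Fin (2*n+1)) (Fin (2*n+1)) ℂ :=
  Matrix.of fun p q => if q = p.rev then 1 else 0

/-- The complex odd orthogonal group `O(2n+1,ℂ) = {X : Xᵀ S X = S}`. -/
def Oodd (n : ℕ) : Set (Matrix (Fin (2*n+1)) (Fin (2*n+1)) ℂ) :=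
  {X | Xᵀ * SmatOdd n * X = SmatOdd n}

theorem SmatOdd_mul_self (n : ℕ) : SmatOdd n * SmatOdd n = 1 := by
  ext p q
  simp only [SmatOdd, Matrix.mul_apply, Matrix.of_apply, ite_mul, one_mul, zero_mul]
  simp [Matrix.one_apply, eq_comm]

/-- The rows of an element of `O(2n+1,ℂ)` satisfy the same relations as its columns. -/
theorem mul_SmatOdd_mul_transpose {n : ℕ} {X : Matrix (Fin (2*n+1)) (Fin (2*n+1)) ℂ}
    (hX : X ∈ Oodd n) : X * SmatOdd n * Xᵀ = SmatOdd n := by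
  have hX' : Xᵀ * SmatOdd n * X = SmatOdd n := hX
  have hinv : (SmatOdd n * Xᵀ * SmatOdd n) * X = 1 := by
    rw [Matrix.mul_assoc, Matrix.mul_assoc, ← Matrix.mul_assoc Xᵀ, hX', SmatOdd_mul_self]
  have hinv' := mul_eq_one_comm.mp hinv
  calc X * SmatOdd n * Xᵀ
      = X * (SmatOdd n * Xᵀ * SmatOdd n) * SmatOdd n := by
        simp only [Matrix.mul_assoc, SmatOdd_mul_self, Matrix.mul_one]
    _ = SmatOdd n := by rw [hinv', Matrix.one_mul]

/-- Two rows of an element of `O(2n+1,ℂ)` that are not opposite are orthogonal. -/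
theorem sum_mul_rev_eq_zero {n : ℕ} {X : Matrix (Fin (2*n+1)) (Fin (2*n+1)) ℂ}
    (hX : X ∈ Oodd n) {p q : Fin (2*n+1)} (hpq : q ≠ p.rev) :
    ∑ c, X p c * X q c.rev = 0 := by
  have h := congrFun (congrFun (mul_SmatOdd_mul_transpose hX) p) q
  rw [Matrix.mul_assoc] at h
  simpa [SmatOdd, Matrix.mul_apply, hpq] using h

/-- The top `n × n` minor on columns `-n,…,-2,c`, as a function of `c`. -/
def topMinor (n : ℕ) (X : Matrix (Fin (2*n+1)) (Fin (2*n+1)) ℂ) (c : Fin (2*n+1)) : ℂ :=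
  (X.submatrix (Fin.castLE (by omega : n ≤ 2*n+1))
    (fun s : Fin n => if (s : ℕ) < n - 1 then s.castLE (by omega) else c)).det

theorem topMinor_eq_zero {n : ℕ} (X : Matrix (Fin (2*n+1)) (Fin (2*n+1)) ℂ)
    {c : Fin (2*n+1)} (hc : (c : ℕ) < n - 1) : topMinor n X c = 0 := by
  refine Matrix.det_zero_of_column_eq
    (i := (⟨c, by omega⟩ : Fin n)) (j := ⟨n - 1, by omega⟩) ?_ ?_
  · simp only [ne_eq, Fin.mk.injEq]
    omega
  · intro s
    simp [hc]

/-- The row of minors `topMinor n X` is a linear combination of the top `n` rows of `X`. -/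
theorem exists_topMinor_eq_sum {n : ℕ} (hn : 1 ≤ n)
    (X : Matrix (Fin (2*n+1)) (Fin (2*n+1)) ℂ) :
    ∃ a : Fin n → ℂ, ∀ c, topMinor n X c = ∑ s : Fin n, a s * X (s.castLE (by omega)) c := by
  let A : Matrix (Fin n) (Fin n) ℂ :=
    X.submatrix (Fin.castLE (by omega)) (Fin.castLE (by omega))
  let l : Fin n := ⟨n - 1, by omega⟩
  refine ⟨fun s => A.adjugate l s, fun c => ?_⟩
  have h := A.cramer_apply (fun s => X (s.castLE (by omega)) c) l
  rw [Matrix.cramer_eq_adjugate_mulVec] at h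
  refine Eq.trans ?_ h.symm
  rw [topMinor]
  congr 1
  ext s t
  by_cases ht : (t : ℕ) < n - 1
  · have htl : t ≠ l := by
      rintro rfl
      exact lt_irrefl _ ht
    simp [ht, htl, A]
  · have htl : t = l := Fin.ext (by simp only [l]; omega)
    subst htl
    simp [l]

theorem sum_topMinor_mul_rev {n : ℕ} (hn : 1 ≤ n)
    {X : Matrix (Fin (2*n+1)) (Fin (2*n+1)) ℂ} (hX : X ∈ Oodd n) :
    ∑ c, topMinor n X c * topMinor n X c.rev = 0 := by
  obtain ⟨a, ha⟩ := exists_topMinor_eq_sum hn X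
  simp only [ha, Finset.sum_mul_sum]
  rw [Finset.sum_comm]
  refine Finset.sum_eq_zero fun s _ => ?_
  rw [Finset.sum_comm]
  refine Finset.sum_eq_zero fun t _ => ?_
  simp only [mul_mul_mul_comm (a s), ← Finset.mul_sum]
  rw [sum_mul_rev_eq_zero hX, mul_zero]
  simp only [ne_eq, Fin.ext_iff, Fin.val_rev, Fin.val_castLE]
  omega

/-- Only the columns `-1, 0, 1` contribute to the sum in `sum_topMinor_mul_rev`. -/
theorem sum_topMinor_mul_rev_eq {n : ℕ} (hn : 1 ≤ n)
    (X : Matrix (Fin (2*n+1)) (Fin (2*n+1)) ℂ) {i j k : Fin (2*n+1)}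
    (hi : (i : ℕ) = n - 1) (hj : (j : ℕ) = n) (hk : (k : ℕ) = n + 1) :
    ∑ c, topMinor n X c * topMinor n X c.rev =
      2 * (topMinor n X k * topMinor n X i) + topMinor n X j ^ 2 := by
  have hsub := Finset.sum_subset (Finset.subset_univ {i, j, k})
    (f := fun c => topMinor n X c * topMinor n X c.rev) (by
      intro c _ hc
      simp only [Finset.mem_insert, Finset.mem_singleton, Fin.ext_iff, not_or] at hc
      by_cases h : (c : ℕ) < n - 1
      · rw [topMinor_eq_zero X h, zero_mul]
      · rw [topMinor_eq_zero X (c := c.rev) (by rw [Fin.val_rev]; omega), mul_zero])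
  have hi_rev : i.rev = k := Fin.ext (by rw [Fin.val_rev]; omega)
  have hj_rev : j.rev = j := Fin.ext (by rw [Fin.val_rev]; omega)
  have hk_rev : k.rev = i := Fin.ext (by rw [Fin.val_rev]; omega)
  rw [← hsub, Finset.sum_insert, Finset.sum_insert, Finset.sum_singleton, hi_rev, hj_rev, hk_rev]
  · ring
  · simp only [Finset.mem_singleton, Fin.ext_iff]
    omega
  · simp only [Finset.mem_insert, Finset.mem_singleton, Fin.ext_iff]
    omega

/-- For column `-1` the columns of the minor are the first `n` ones. -/
theorem topMinor_pred {n : ℕ} (X : Matrix (Fin (2*n+1)) (Fin (2*n+1)) ℂ)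
    {i : Fin (2*n+1)} (hi : (i : ℕ) = n - 1) :
    topMinor n X i =
      (X.submatrix (Fin.castLE (by omega : n ≤ 2*n+1)) (Fin.castLE (by omega))).det := by
  rw [topMinor]
  congr 2
  ext s
  split_ifs
  · rfl
  · rw [hi, Fin.val_castLE]
    omega

/-- For `X ∈ O(2n+1,ℂ)`:
`a_{-n,…,-2,1}(X) · a_{-n,…,-2,-1}(X) = -(1/2) · a_{-n,…,-2,0}(X)²`,
where minors are taken over the top `n` rows (rows `-n,…,-1`, positions
`0,…,n-1`), with columns `-n,…,-2,1` (positions `0,…,n-2` and `n+1`),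
columns `-n,…,-2,-1` (positions `0,…,n-1`) and columns `-n,…,-2,0`
(positions `0,…,n-2` and `n`). -/
theorem statement4 (n : ℕ) (hn : 1 ≤ n) (X : Matrix (Fin (2*n+1)) (Fin (2*n+1)) ℂ)
    (hX : X ∈ Oodd n) :
    (X.submatrix (fun s : Fin n => (⟨(s : ℕ), by have := s.isLt; omega⟩ : Fin (2*n+1)))
        (fun s : Fin n =>
          if (s : ℕ) < n - 1 then (⟨(s : ℕ), by have := s.isLt; omega⟩ : Fin (2*n+1))
          else ⟨n + 1, by omega⟩)).det
      * (X.submatrix (fun s : Fin n => (⟨(s : ℕ), by have := s.isLt; omega⟩ : Fin (2*n+1)))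
        (fun s : Fin n => (⟨(s : ℕ), by have := s.isLt; omega⟩ : Fin (2*n+1)))).det
    = -(1/2 : ℂ) *
      ((X.submatrix (fun s : Fin n => (⟨(s : ℕ), by have := s.isLt; omega⟩ : Fin (2*n+1)))
        (fun s : Fin n =>
          if (s : ℕ) < n - 1 then (⟨(s : ℕ), by have := s.isLt; omega⟩ : Fin (2*n+1))
          else ⟨n, by omega⟩)).det) ^ 2 := by
  have hsum := sum_topMinor_mul_rev_eq hn X (i := ⟨n - 1, by omega⟩) (j := ⟨n, by omega⟩)
    (k := ⟨n + 1, by omega⟩) rfl rfl rfl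
  rw [sum_topMinor_mul_rev hn hX] at hsum
  have hpred := topMinor_pred X (i := ⟨n - 1, by omega⟩) rfl
  change topMinor n X ⟨n + 1, _⟩ * (X.submatrix (Fin.castLE (by omega)) (Fin.castLE (by omega))).det =
    -(1/2 : ℂ) * topMinor n X ⟨n, _⟩ ^ 2
  rw [← hpred]
  linear_combination -(1/2 : ℂ) * hsum
end
end

section
/- Let n ≥ 2. For every X ∈ O(2n,ℂ) one has a_{-n,…,-3,2}(X) · a_{-n,…,-3,-2}(X) = −a_{-n,…,-3,1}(X) · a_{-n,…,-3,-1}(X), where all four minors are (n−1)×(n−1) determinants taken over the top n−1 rows (rows -n,…,-2) of X, with column sets {-n,…,-3,2}, {-n,…,-3,-2}, {-n,…,-3,1}, {-n,…,-3,-1} respectively. -/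
open Matrix

noncomputable section

/-- The matrix `S` with `S_{k,-k} = 1` and all other entries `0`; rows and
columns are indexed by the ordered set `I_n = {-n,…,-1,1,…,n}` via positions
`0,…,2n-1`, and `-k` corresponds to position reversal `Fin.rev`. -/
def SmatE (n : ℕ) : Matrix (Fin (2*n)) (Fin (2*n)) ℂ :=
  Matrix.of fun p q => if q = p.rev then 1 else 0

/-- The complex even orthogonal group `O(2n,ℂ) = {X : Xᵀ S X = S}`. -/
def Oeven (n : ℕ) : Set (Matrix (Fin (2*n)) (Fin (2*n)) ℂ) :=
  {X | Xᵀ * SmatE n * X = SmatE n}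

/-- The special orthogonal group `SO(2n,ℂ) = {X ∈ O(2n,ℂ) : det X = 1}`. -/
def SOeven (n : ℕ) : Set (Matrix (Fin (2*n)) (Fin (2*n)) ℂ) :=
  {X | X ∈ Oeven n ∧ X.det = 1}

/-- The rows of an orthogonal matrix satisfy the same orthogonality relations as its columns. -/
lemma mul_SmatE_mul_transpose_of_mem_Oeven {n : ℕ} {X : Matrix (Fin (2*n)) (Fin (2*n)) ℂ}
    (hX : X ∈ Oeven n) : X * SmatE n * Xᵀ = SmatE n := by
  have hS : SmatE n * SmatE n = 1 := by
    ext p q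
    rw [Matrix.mul_apply, Finset.sum_eq_single p.rev]
    · simp [SmatE, Matrix.one_apply, eq_comm]
    · intro j _ hj
      simp [SmatE, hj]
    · simp
  have h₁ : (SmatE n * Xᵀ * SmatE n) * X = 1 := by
    rw [Matrix.mul_assoc (SmatE n), Matrix.mul_assoc (SmatE n), show Xᵀ * SmatE n * X = _ from hX,
      hS]
  have h₂ := mul_eq_one_comm.mp h₁
  calc X * SmatE n * Xᵀ = X * (SmatE n * Xᵀ * SmatE n) * SmatE n := by
        simp only [Matrix.mul_assoc, hS, Matrix.mul_one]
    _ = SmatE n := by rw [h₂, Matrix.one_mul]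

lemma sum_row_mul_row_rev {n : ℕ} {X : Matrix (Fin (2*n)) (Fin (2*n)) ℂ}
    (hX : X ∈ Oeven n) (i j : Fin (2*n)) :
    ∑ q, X i q * X j q.rev = if j = i.rev then 1 else 0 := by
  have h := congrFun₂ (mul_SmatE_mul_transpose_of_mem_Oeven hX) i j
  rw [Matrix.mul_assoc] at h
  simpa [SmatE, Matrix.mul_apply] using h

/-- A linear combination of mutually orthogonal isotropic rows is isotropic. -/
lemma sum_vecMul_mul_vecMul_rev {n k : ℕ} {X : Matrix (Fin (2*n)) (Fin (2*n)) ℂ}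
    (hX : X ∈ Oeven n) (r : Fin k → Fin (2*n)) (hr : ∀ i j, r j ≠ (r i).rev) (c : Fin k → ℂ) :
    ∑ q, (∑ i, c i * X (r i) q) * (∑ i, c i * X (r i) q.rev) = 0 := by
  simp_rw [Finset.sum_mul_sum]
  rw [Finset.sum_comm]
  refine Finset.sum_eq_zero fun i _ => ?_
  rw [Finset.sum_comm]
  refine Finset.sum_eq_zero fun j _ => ?_
  have h := sum_row_mul_row_rev hX (r i) (r j)
  rw [if_neg (hr i j)] at h
  calc ∑ q, c i * X (r i) q * (c j * X (r j) q.rev)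
      = c i * c j * ∑ q, X (r i) q * X (r j) q.rev := by
        rw [Finset.mul_sum]
        exact Finset.sum_congr rfl fun q _ => by ring
    _ = 0 := by rw [h, mul_zero]

/-- For `X ∈ O(2n,ℂ)`:
`a_{-n,…,-3,2}(X) · a_{-n,…,-3,-2}(X) = − a_{-n,…,-3,1}(X) · a_{-n,…,-3,-1}(X)`,
all four minors of size `(n-1) × (n-1)` over the top `n-1` rows (positions
`0,…,n-2`), with column sets `{-n,…,-3,2}` (positions `0,…,n-3`, `n+1`),
`{-n,…,-3,-2}` (positions `0,…,n-2`), `{-n,…,-3,1}` (positions `0,…,n-3`, `n`)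
and `{-n,…,-3,-1}` (positions `0,…,n-3`, `n-1`). -/
theorem statement5 (n : ℕ) (hn : 2 ≤ n) (X : Matrix (Fin (2*n)) (Fin (2*n)) ℂ)
    (hX : X ∈ Oeven n) :
    (X.submatrix (fun s : Fin (n-1) => (⟨(s : ℕ), by have := s.isLt; omega⟩ : Fin (2*n)))
        (fun s : Fin (n-1) =>
          if (s : ℕ) < n - 2 then (⟨(s : ℕ), by have := s.isLt; omega⟩ : Fin (2*n))
          else ⟨n + 1, by omega⟩)).det
      * (X.submatrix (fun s : Fin (n-1) => (⟨(s : ℕ), by have := s.isLt; omega⟩ : Fin (2*n)))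
        (fun s : Fin (n-1) => (⟨(s : ℕ), by have := s.isLt; omega⟩ : Fin (2*n)))).det
    = - ((X.submatrix (fun s : Fin (n-1) => (⟨(s : ℕ), by have := s.isLt; omega⟩ : Fin (2*n)))
        (fun s : Fin (n-1) =>
          if (s : ℕ) < n - 2 then (⟨(s : ℕ), by have := s.isLt; omega⟩ : Fin (2*n))
          else ⟨n, by omega⟩)).det
      * (X.submatrix (fun s : Fin (n-1) => (⟨(s : ℕ), by have := s.isLt; omega⟩ : Fin (2*n)))
        (fun s : Fin (n-1) =>
          if (s : ℕ) < n - 2 then (⟨(s : ℕ), by have := s.isLt; omega⟩ : Fin (2*n))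
          else ⟨n - 1, by omega⟩)).det) := by
  obtain ⟨m, rfl⟩ : ∃ m, n = m + 2 := ⟨n - 2, by omega⟩
  let r : Fin (m + 1) → Fin (2 * (m + 2)) := fun s => ⟨s, by omega⟩
  let col : Fin (2 * (m + 2)) → Fin (m + 1) → Fin (2 * (m + 2)) :=
    fun q s => if (s : ℕ) < m then ⟨s, by omega⟩ else q
  let f : Fin (2 * (m + 2)) → ℂ := fun q => (X.submatrix r (col q)).det
  have hf : ∀ q, f q = ∑ i, (X.submatrix r r).adjugate (Fin.last m) i * X (r i) q := by
    intro q
    have h : X.submatrix r (col q) =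
        (X.submatrix r r).updateCol (Fin.last m) fun i => X (r i) q := by
      ext i s
      induction s using Fin.lastCases <;> simp [col, r, Matrix.updateCol_apply, Fin.ext_iff]
      omega
    change (X.submatrix r (col q)).det = _
    rw [h, ← Matrix.cramer_apply, Matrix.cramer_eq_adjugate_mulVec]
    rfl
  have hf_zero : ∀ q : Fin (2 * (m + 2)), (q : ℕ) < m → f q = 0 := by
    intro q hq
    refine Matrix.det_zero_of_column_eq (i := ⟨q, by omega⟩) (j := Fin.last m) ?_ ?_
    · simp [Fin.ext_iff, hq.ne]
    · intro i
      simp [col, hq]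
  have hsum : ∑ q, f q * f q.rev = 0 := by
    simp_rw [hf]
    exact sum_vecMul_mul_vecMul_rev hX r
      (fun i j h => by have := congrArg Fin.val h; simp [r, Fin.val_rev] at this; omega) _
  have hfour : f ⟨m, by omega⟩ * f ⟨m + 3, by omega⟩ + f ⟨m + 1, by omega⟩ * f ⟨m + 2, by omega⟩
      + f ⟨m + 2, by omega⟩ * f ⟨m + 1, by omega⟩ + f ⟨m + 3, by omega⟩ * f ⟨m, by omega⟩ = 0 := by
    rw [← hsum, ← Finset.sum_subset (Finset.subset_univ
      ({⟨m, by omega⟩, ⟨m + 1, by omega⟩, ⟨m + 2, by omega⟩, ⟨m + 3, by omega⟩} :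
        Finset (Fin (2 * (m + 2)))))]
    · have h₀ : Fin.rev (⟨m, by omega⟩ : Fin (2 * (m + 2))) = ⟨m + 3, by omega⟩ := by
        ext; simp [Fin.val_rev]; omega
      have h₁ : Fin.rev (⟨m + 1, by omega⟩ : Fin (2 * (m + 2))) = ⟨m + 2, by omega⟩ := by
        ext; simp [Fin.val_rev]; omega
      have h₂ : Fin.rev (⟨m + 2, by omega⟩ : Fin (2 * (m + 2))) = ⟨m + 1, by omega⟩ := by
        ext; simp [Fin.val_rev]; omega
      have h₃ : Fin.rev (⟨m + 3, by omega⟩ : Fin (2 * (m + 2))) = ⟨m, by omega⟩ := by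
        ext; simp [Fin.val_rev]; omega
      repeat rw [Finset.sum_insert (by simp [Fin.ext_iff])]
      rw [Finset.sum_singleton, h₀, h₁, h₂, h₃]
      ring
    · intro q _ hq
      simp only [Finset.mem_insert, Finset.mem_singleton, Fin.ext_iff, not_or] at hq
      rcases lt_or_ge (q : ℕ) m with h | h
      · rw [hf_zero q h, zero_mul]
      · rw [hf_zero q.rev (by rw [Fin.val_rev]; omega), mul_zero]
  have hcol : col ⟨m, by omega⟩ = r := by
    funext s
    ext
    simp only [col, r]
    split_ifs
    · rfl
    · simp
      omega
  have hf_r : f ⟨m, by omega⟩ = (X.submatrix r r).det := by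
    change (X.submatrix r (col _)).det = _
    rw [hcol]
  change f ⟨m + 3, _⟩ * (X.submatrix r r).det = -(f ⟨m + 2, _⟩ * f ⟨m + 1, _⟩)
  rw [← hf_r]
  linear_combination hfour / 2
end
end

section
/- Let n ≥ 2. For every X ∈ SO(2n,ℂ) one has a_{-n,…,-2,1}(X) = 0; that is, the determinant of the n×n submatrix of X with rows -n,…,-1 (the top n rows) and columns -n,…,-2,1 vanishes. -/
open Matrix

noncomputable section

/-- If `Y` preserves the split symmetric form and has determinant `-1`, then its upper left block
is singular. -/
theorem det_block_eq_zero_of_orthogonal {m K : Type*} [Fintype m] [DecidableEq m]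
    [Field K] [CharZero K] (A B C D : Matrix m m K)
    (hY : (fromBlocks A B C D)ᵀ * fromBlocks 0 1 1 0 * fromBlocks A B C D = fromBlocks 0 1 1 0)
    (hdet : (fromBlocks A B C D).det = -1) : A.det = 0 := by
  have hinv : fromBlocks A B C D *
      (fromBlocks 0 1 1 0 * ((fromBlocks A B C D)ᵀ * fromBlocks 0 1 1 0)) = 1 := by
    rw [mul_eq_one_comm, Matrix.mul_assoc, hY, fromBlocks_multiply]
    simp
  simp only [fromBlocks_transpose, fromBlocks_multiply, ← fromBlocks_one, fromBlocks_inj,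
    Matrix.zero_mul, Matrix.mul_zero, Matrix.one_mul, Matrix.mul_one, zero_add, add_zero] at hinv
  obtain ⟨-, hAB, -, hCD⟩ := hinv
  have hmul : fromBlocks A B C D * fromBlocks 1 Bᵀ 0 Aᵀ = fromBlocks A 0 C 1 := by
    simp [fromBlocks_multiply, hAB, hCD]
  have h := congrArg Matrix.det hmul
  rw [det_mul, hdet, det_fromBlocks_zero₂₁, det_fromBlocks_zero₁₂, det_transpose, det_one,
    one_mul, mul_one] at h
  exact self_eq_neg.mp (by rw [← neg_one_mul, h])

/-- The splitting of positions `0,…,2n-1` into the first `n` and their reversals. -/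
def halvesEquiv (n : ℕ) : Fin n ⊕ Fin n ≃ Fin (2 * n) :=
  (Equiv.sumCongr (Equiv.refl _) Fin.revPerm).trans
    (finSumFinEquiv.trans (finCongr (two_mul n).symm))

theorem halvesEquiv_inl_val (n : ℕ) (i : Fin n) : (halvesEquiv n (Sum.inl i) : ℕ) = i := by
  simp [halvesEquiv]

theorem halvesEquiv_inr_val (n : ℕ) (i : Fin n) :
    (halvesEquiv n (Sum.inr i) : ℕ) = n + (n - (i + 1)) := by
  simp [halvesEquiv, add_comm]

theorem rev_halvesEquiv (n : ℕ) (x : Fin n ⊕ Fin n) :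
    (halvesEquiv n x).rev = halvesEquiv n x.swap := by
  rcases x with i | i <;> ext <;>
    simp only [Fin.val_rev, Sum.swap_inl, Sum.swap_inr, halvesEquiv_inl_val,
      halvesEquiv_inr_val] <;> omega

theorem SmatE_submatrix_halvesEquiv (n : ℕ) :
    (SmatE n).submatrix (halvesEquiv n) (halvesEquiv n) = fromBlocks 0 1 1 0 := by
  ext x y
  rcases x with i | i <;> rcases y with j | j <;>
    simp [SmatE, rev_halvesEquiv, Matrix.one_apply, eq_comm]

theorem splitForm_submatrix_swap {m R : Type*} [DecidableEq m] [Zero R] [One R] (l : m) :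
    (fromBlocks 0 1 1 0 : Matrix (m ⊕ m) (m ⊕ m) R).submatrix
      (Equiv.swap (Sum.inl l) (Sum.inr l)) (Equiv.swap (Sum.inl l) (Sum.inr l)) =
      fromBlocks 0 1 1 0 := by
  ext x y
  rcases x with i | i <;> rcases y with j | j <;> by_cases hi : i = l <;> by_cases hj : j = l <;>
    simp [Equiv.swap_apply_def, Matrix.one_apply, hi, hj, eq_comm (a := l)]

/-- For `X ∈ SO(2n,ℂ)`: `a_{-n,…,-2,1}(X) = 0`, the minor over the top `n`
rows (positions `0,…,n-1`) with columns `-n,…,-2,1` (positions `0,…,n-2`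
and `n`). -/
theorem statement6 (n : ℕ) (hn : 2 ≤ n) (X : Matrix (Fin (2*n)) (Fin (2*n)) ℂ)
    (hX : X ∈ SOeven n) :
    (X.submatrix (fun s : Fin n => (⟨(s : ℕ), by have := s.isLt; omega⟩ : Fin (2*n)))
        (fun s : Fin n =>
          if (s : ℕ) < n - 1 then (⟨(s : ℕ), by have := s.isLt; omega⟩ : Fin (2*n))
          else ⟨n, by omega⟩)).det = 0 := by
  obtain ⟨hO, hdet⟩ := hX
  set l : Fin n := ⟨n - 1, by omega⟩ with hl
  set e := halvesEquiv n
  set f := (Equiv.swap (Sum.inl l) (Sum.inr l)).trans e with hf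
  have hSf : (SmatE n).submatrix f f = fromBlocks 0 1 1 0 := by
    rw [← splitForm_submatrix_swap l, ← SmatE_submatrix_halvesEquiv n]
    rfl
  have hY : (X.submatrix e f)ᵀ * fromBlocks 0 1 1 0 * X.submatrix e f = fromBlocks 0 1 1 0 := by
    have h := congrArg (fun M => M.submatrix f f) (show Xᵀ * SmatE n * X = SmatE n from hO)
    simp only [hSf] at h
    rw [← SmatE_submatrix_halvesEquiv n, transpose_submatrix, submatrix_mul_equiv,
      submatrix_mul_equiv, h, SmatE_submatrix_halvesEquiv n]
  have hdetY : (X.submatrix e f).det = -1 := by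
    have h := det_permute' (Equiv.swap (Sum.inl l) (Sum.inr l)) (X.submatrix e e)
    rw [Equiv.Perm.sign_swap (by simp), det_submatrix_equiv_self, hdet] at h
    simpa [hf] using h
  rw [← fromBlocks_toBlocks (X.submatrix e f)] at hY hdetY
  rw [← det_block_eq_zero_of_orthogonal _ _ _ _ hY hdetY]
  congr 1
  ext i j
  simp only [submatrix_apply, toBlocks₁₁, of_apply]
  refine congrArg₂ X (Fin.ext (halvesEquiv_inl_val n i).symm) (Fin.ext ?_)
  by_cases hj : j = l
  · subst hj
    simp only [hf, Equiv.trans_apply, Equiv.swap_apply_left, e, halvesEquiv_inr_val, hl,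
      lt_irrefl, if_false]
    omega
  · have hlt : (j : ℕ) < n - 1 := by
      have : (j : ℕ) ≠ n - 1 := fun h => hj (Fin.ext h)
      omega
    rw [if_pos hlt, hf, Equiv.trans_apply,
      Equiv.swap_apply_of_ne_of_ne (by simpa using hj) (by simp), halvesEquiv_inl_val]
end
end

section
/- Let n ≥ 2. For every X ∈ SO(2n,ℂ) one has ā_{-n,…,-2,-1}(X) = 0; that is, the determinant of the n×n submatrix of X with rows -n,…,-2,1 (the first n−1 rows together with row 1) and columns -n,…,-2,-1 vanishes. -/
open Matrix

noncomputable section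

/-- The determinant of a matrix preserving the split symmetric form `fromBlocks 0 1 1 0` fixes, by
multiplication, the determinant of its upper left block. -/
theorem det_mul_det_toBlocks₁₁_of_split_orthogonal {m R : Type*} [Fintype m] [DecidableEq m]
    [CommRing R] (Y : Matrix (m ⊕ m) (m ⊕ m) R)
    (hY : Yᵀ * fromBlocks 0 1 1 0 * Y = fromBlocks 0 1 1 0) :
    Y.det * Y.toBlocks₁₁.det = Y.toBlocks₁₁.det := by
  have hinv : Y * (fromBlocks 0 1 1 0 * Yᵀ * fromBlocks 0 1 1 0) = 1 := by
    rw [mul_eq_one_comm, Matrix.mul_assoc, Matrix.mul_assoc, ← Matrix.mul_assoc Yᵀ, hY]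
    simp [fromBlocks_multiply]
  rw [← fromBlocks_toBlocks Y] at hinv ⊢
  generalize Y.toBlocks₁₁ = A, Y.toBlocks₁₂ = B, Y.toBlocks₂₁ = C, Y.toBlocks₂₂ = D at hinv ⊢
  simp only [fromBlocks_transpose, fromBlocks_multiply, ← fromBlocks_one, fromBlocks_inj,
    Matrix.zero_mul, Matrix.one_mul, Matrix.mul_zero, Matrix.mul_one, zero_add, add_zero] at hinv
  have h : fromBlocks A B C D * fromBlocks 1 Bᵀ 0 Aᵀ = fromBlocks A 0 C 1 := by
    simp [fromBlocks_multiply, hinv.2.1, hinv.2.2.2]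
  simpa using congrArg det h

/-- The indices `0, …, n-1` followed by their reversals. -/
def sumFinRevEquiv (n : ℕ) : Fin n ⊕ Fin n ≃ Fin (2 * n) :=
  ((Equiv.sumCongr (Equiv.refl _) Fin.revPerm).trans finSumFinEquiv).trans
    (finCongr (two_mul n).symm)

theorem sumFinRevEquiv_inl_val (n : ℕ) (i : Fin n) :
    (sumFinRevEquiv n (Sum.inl i) : ℕ) = i := by
  simp [sumFinRevEquiv]

theorem sumFinRevEquiv_inr (n : ℕ) (i : Fin n) :
    sumFinRevEquiv n (Sum.inr i) = (sumFinRevEquiv n (Sum.inl i)).rev := by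
  ext
  simp [sumFinRevEquiv, Fin.val_rev]
  omega

/-- If `e` is an enumeration whose second half is the reversal of its first half, then `SmatE`
becomes the split form. -/
theorem SmatE_submatrix (n : ℕ) (e : Fin n ⊕ Fin n ≃ Fin (2 * n))
    (he : ∀ i, e (Sum.inr i) = (e (Sum.inl i)).rev) :
    (SmatE n).submatrix e e = fromBlocks 0 1 1 0 := by
  have hne (i j : Fin n) : e (Sum.inl j) ≠ (e (Sum.inl i)).rev := by
    rw [← he]
    simp
  ext (i | i) (j | j)
  · simp [SmatE, hne]
  · simp [SmatE, he, Matrix.one_apply, eq_comm]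
  · simp [SmatE, he, Matrix.one_apply, eq_comm]
  · simpa [SmatE, he, Fin.rev_eq_iff] using hne i j

/-- For `X ∈ SO(2n,ℂ)`: `ā_{-n,…,-2,-1}(X) = 0`, the minor over rows
`-n,…,-2,1` (positions `0,…,n-2` and `n`) with columns `-n,…,-2,-1`
(positions `0,…,n-1`). -/
theorem statement7 (n : ℕ) (hn : 2 ≤ n) (X : Matrix (Fin (2*n)) (Fin (2*n)) ℂ)
    (hX : X ∈ SOeven n) :
    (X.submatrix
        (fun s : Fin n =>
          if (s : ℕ) < n - 1 then (⟨(s : ℕ), by have := s.isLt; omega⟩ : Fin (2*n))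
          else ⟨n, by omega⟩)
        (fun s : Fin n => (⟨(s : ℕ), by have := s.isLt; omega⟩ : Fin (2*n)))).det = 0 := by
  obtain ⟨hO, hdet⟩ := hX
  set a : Fin (2 * n) := ⟨n - 1, by omega⟩ with ha
  set b : Fin (2 * n) := ⟨n, by omega⟩ with hb
  have hab : a ≠ b := by simp [ha, hb]; omega
  have hrev : a.rev = b := by ext; simp [ha, hb, Fin.val_rev]; omega
  let e := sumFinRevEquiv n
  let f := e.trans (Equiv.swap a b)
  have hswap (x : Fin (2 * n)) : Equiv.swap a b x.rev = (Equiv.swap a b x).rev := by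
    have hrev' : b.rev = a := by rw [← hrev, Fin.rev_rev]
    simp only [Equiv.swap_apply_def, Fin.rev_eq_iff, hrev, hrev']
    split_ifs <;> simp_all
  have hf (i : Fin n) : f (Sum.inr i) = (f (Sum.inl i)).rev := by
    simp only [f, e, Equiv.trans_apply, sumFinRevEquiv_inr, hswap]
  have hY : (X.submatrix f e)ᵀ * fromBlocks 0 1 1 0 * X.submatrix f e = fromBlocks 0 1 1 0 := by
    have h := congrArg (fun M => M.submatrix e e) (show Xᵀ * SmatE n * X = SmatE n from hO)
    simp only [SmatE_submatrix n e (sumFinRevEquiv_inr n)] at h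
    rw [← SmatE_submatrix n f hf, transpose_submatrix, submatrix_mul_equiv, submatrix_mul_equiv, h,
      SmatE_submatrix n f hf]
  have hdetY : (X.submatrix f e).det = -1 := by
    have h : X.submatrix f e = (X.submatrix (Equiv.swap a b) id).submatrix e e := rfl
    rw [h, det_submatrix_equiv_self, det_permute, hdet, Equiv.Perm.sign_swap hab]
    simp
  have h := det_mul_det_toBlocks₁₁_of_split_orthogonal _ hY
  rw [hdetY, neg_one_mul, neg_eq_self] at h
  convert h using 2
  ext i j
  have hrow : f (Sum.inl i) = if (i : ℕ) < n - 1 then ⟨i, by omega⟩ else b := by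
    have hi : e (Sum.inl i) = ⟨i, by omega⟩ := Fin.ext (sumFinRevEquiv_inl_val n i)
    simp only [f, Equiv.trans_apply, hi, Equiv.swap_apply_def, ha, hb, Fin.mk.injEq]
    split_ifs <;> first | rfl | omega
  have hcol : e (Sum.inl j) = ⟨j, by omega⟩ := Fin.ext (sumFinRevEquiv_inl_val n j)
  simp only [toBlocks₁₁, submatrix_apply, of_apply, hrow, hcol]
end
end

section
/- Let n ≥ 2. For every X ∈ SO(2n,ℂ) one has a_{-n,…,-3,-1,1}(X) · a_{-n,…,-3,-2}(X) = −a_{-n,…,-3,1}(X) · a_{-n,…,-3,-2,-1}(X), where a_{-n,…,-3,-1,1} and a_{-n,…,-3,-2,-1} are n×n minors over the top n rows (rows -n,…,-1) with column sets {-n,…,-3,-1,1} and {-n,…,-3,-2,-1}, and a_{-n,…,-3,-2} and a_{-n,…,-3,1} are (n−1)×(n−1) minors over the top n−1 rows (rows -n,…,-2) with column sets {-n,…,-3,-2} and {-n,…,-3,1}. -/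
open Matrix

noncomputable section

/-- If `Zᵀ J Z = J` for `J = [[0, 1], [1, 0]]` and `det Z = -1`, the upper left block of `Z`
is singular. -/
lemma det_toBlocks₁₁_eq_zero_of_det_eq_neg_one {ι : Type*} [Fintype ι] [DecidableEq ι]
    (Z : Matrix (ι ⊕ ι) (ι ⊕ ι) ℂ)
    (hZ : Zᵀ * fromBlocks 0 1 1 0 * Z = fromBlocks 0 1 1 0) (hdet : Z.det = -1) :
    Z.toBlocks₁₁.det = 0 := by
  obtain ⟨A, B, C, D, rfl⟩ : ∃ A B C D, Z = fromBlocks A B C D :=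
    ⟨_, _, _, _, (fromBlocks_toBlocks Z).symm⟩
  simp only [fromBlocks_transpose, fromBlocks_multiply, fromBlocks_inj, mul_zero, mul_one,
    zero_add, add_zero] at hZ
  obtain ⟨h₁, -, h₂, -⟩ := hZ
  have key : (fromBlocks A B C D)ᵀ * fromBlocks 1 C 0 A = fromBlocks Aᵀ 0 Bᵀ 1 := by
    simp only [fromBlocks_transpose, fromBlocks_multiply, mul_zero, mul_one, add_zero]
    rw [add_comm (Aᵀ * C), add_comm (Bᵀ * C), h₁, h₂]
  have h := congrArg det key
  rw [det_mul, det_transpose, hdet, det_fromBlocks_zero₂₁, det_fromBlocks_zero₁₂] at h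
  simp only [det_one, det_transpose, one_mul, mul_one] at h
  rw [toBlocks_fromBlocks₁₁]
  linear_combination -(1 / 2 : ℂ) * h

/-- For a singular matrix, any two vectors in the image of the adjugate are proportional. -/
lemma cramer_mul_cramer_comm_of_det_eq_zero {ι : Type*} [Fintype ι] [DecidableEq ι]
    {N : Matrix ι ι ℂ} (hN : N.det = 0) (b c : ι → ℂ) (i j : ι) :
    N.cramer b i * N.cramer c j = N.cramer b j * N.cramer c i := by
  set w : ι → ℂ := N.cramer c j • N.cramer b - N.cramer b j • N.cramer c with hw
  have hNw : N *ᵥ w = 0 := by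
    simp [hw, mulVec_sub, mulVec_smul, mulVec_cramer, hN]
  have hwj : w j = 0 := by
    simp [hw, mul_comm]
  have hcramer (x : ι → ℂ) (hw0 : w ≠ 0) : N.cramer x j = 0 := by
    rw [cramer_apply]
    refine exists_mulVec_eq_zero_iff.mp ⟨w, hw0, ?_⟩
    rw [← hNw]
    ext k
    refine Finset.sum_congr rfl fun l _ => ?_
    by_cases hl : l = j
    · simp [hl, hwj]
    · simp [hl]
  have hw0 : w = 0 := by
    by_contra h
    exact h (by simp [hw, hcramer _ h])
  have hwi := congrFun hw0 i
  simp only [hw, Pi.sub_apply, Pi.smul_apply, smul_eq_mul, Pi.zero_apply] at hwi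
  linear_combination hwi

/-- Cramer's rule applied to a standard basis vector yields a cofactor. -/
lemma cramer_single_one {m : ℕ} (N : Matrix (Fin (m + 1)) (Fin (m + 1)) ℂ) (i j : Fin (m + 1)) :
    N.cramer (Pi.single j 1) i =
      (-1) ^ (j + i : ℕ) * (N.submatrix j.succAbove i.succAbove).det := by
  rw [cramer_eq_adjugate_mulVec, mulVec_single_one, col_apply, adjugate_fin_succ_eq_det_submatrix]

/-- The indexing of `Fin (2 * n)` by its lower half and the reversal of its lower half. -/
def halfRevEquiv (n : ℕ) : Fin n ⊕ Fin n ≃ Fin (2 * n) :=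
  Equiv.ofBijective
    (Sum.elim (fun i => ⟨i, by omega⟩) (fun i => (⟨i, by omega⟩ : Fin (2 * n)).rev)) <| by
    rw [Fintype.bijective_iff_injective_and_card]
    refine ⟨?_, by simp [two_mul]⟩
    rintro (i | i) (j | j) h <;> simp only [Sum.elim_inl, Sum.elim_inr, Fin.ext_iff,
      Fin.val_rev, Sum.inl.injEq, Sum.inr.injEq, reduceCtorEq] at h ⊢ <;> omega

lemma smatE_submatrix_halfRevEquiv (n : ℕ) :
    (SmatE n).submatrix (halfRevEquiv n) (halfRevEquiv n) = fromBlocks 0 1 1 0 := by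
  ext (i | i) (j | j) <;> simp only [SmatE, halfRevEquiv, submatrix_apply, of_apply,
    Equiv.ofBijective_apply, Sum.elim_inl, Sum.elim_inr, fromBlocks_apply₁₁, fromBlocks_apply₁₂,
    fromBlocks_apply₂₁, fromBlocks_apply₂₂, Matrix.zero_apply, one_apply, Fin.ext_iff, Fin.val_rev] <;>
    split_ifs <;> first | rfl | omega

lemma smatE_submatrix_swap_rev (n : ℕ) (k : Fin (2 * n)) :
    (SmatE n).submatrix (Equiv.swap k k.rev) (Equiv.swap k k.rev) = SmatE n := by
  ext p q
  simp only [SmatE, submatrix_apply, of_apply]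
  congr 1
  have h : (Equiv.swap k k.rev p).rev = Equiv.swap k k.rev p.rev := by
    simp only [Equiv.swap_apply_def, apply_ite Fin.rev, Fin.rev_rev, Fin.rev_eq_iff]
    split_ifs <;> simp_all
  rw [h, (Equiv.swap k k.rev).injective.eq_iff]

/-- The minor of the first `n` rows of `X ∈ SO(2n, ℂ)` with columns `-n, …, -2, 1` vanishes. -/
lemma SOeven.det_submatrix_eq_zero (m : ℕ) {X : Matrix (Fin (2 * (m + 2))) (Fin (2 * (m + 2))) ℂ}
    (hX : X ∈ SOeven (m + 2)) :
    (X.submatrix (fun s : Fin (m + 2) => (⟨s, by omega⟩ : Fin (2 * (m + 2))))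
      (fun s : Fin (m + 2) => if (s : ℕ) < m + 1 then (⟨s, by omega⟩ : Fin (2 * (m + 2)))
        else ⟨m + 2, by omega⟩)).det = 0 := by
  obtain ⟨hO, hdet⟩ := hX
  set k : Fin (2 * (m + 2)) := ⟨m + 1, by omega⟩ with hk
  have hkrev : k.rev = ⟨m + 2, by omega⟩ := by
    simp only [hk, Fin.ext_iff, Fin.val_rev]
    omega
  set e := halfRevEquiv (m + 2)
  set σ := Equiv.swap k k.rev with hσ
  set Y := X.submatrix id σ with hY
  have hYO : Yᵀ * SmatE (m + 2) * Y = SmatE (m + 2) := by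
    have h := congrArg (fun M => M.submatrix σ σ) (show Xᵀ * SmatE (m + 2) * X = _ from hO)
    simp only [smatE_submatrix_swap_rev, hσ] at h
    exact h
  have hYdet : Y.det = -1 := by
    have hne : k ≠ k.rev := by rw [hkrev, hk, Ne, Fin.ext_iff]; simp
    rw [hY, det_permute', hdet, hσ, Equiv.Perm.sign_swap hne]
    simp
  have hZ := det_toBlocks₁₁_eq_zero_of_det_eq_neg_one (Y.submatrix e e)
    (by
      have h := congrArg (fun M => M.submatrix e e) hYO
      simp only [← submatrix_mul_equiv _ _ e e e, smatE_submatrix_halfRevEquiv, e] at h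
      exact h)
    (by rw [det_submatrix_equiv_self, hYdet])
  rw [← hZ]
  congr 1
  ext i j
  change X _ _ = X _ (Equiv.swap k k.rev ⟨j, _⟩)
  congr 1
  rw [hkrev, Equiv.swap_apply_def]
  simp only [hk, Fin.ext_iff]
  split_ifs <;> first | rfl | omega

/-- For `X ∈ SO(2n,ℂ)`:
`a_{-n,…,-3,-1,1}(X) · a_{-n,…,-3,-2}(X) = − a_{-n,…,-3,1}(X) · a_{-n,…,-3,-2,-1}(X)`.
The first and last are `n × n` minors over the top `n` rows with columns
`{-n,…,-3,-1,1}` (positions `0,…,n-3`, `n-1`, `n`) resp. `{-n,…,-3,-2,-1}`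
(positions `0,…,n-1`); the middle two are `(n-1) × (n-1)` minors over the top
`n-1` rows with columns `{-n,…,-3,-2}` (positions `0,…,n-2`) resp.
`{-n,…,-3,1}` (positions `0,…,n-3`, `n`). -/
theorem statement8 (n : ℕ) (hn : 2 ≤ n) (X : Matrix (Fin (2*n)) (Fin (2*n)) ℂ)
    (hX : X ∈ SOeven n) :
    (X.submatrix (fun s : Fin n => (⟨(s : ℕ), by have := s.isLt; omega⟩ : Fin (2*n)))
        (fun s : Fin n =>
          if (s : ℕ) < n - 2 then (⟨(s : ℕ), by have := s.isLt; omega⟩ : Fin (2*n))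
          else if (s : ℕ) = n - 2 then (⟨n - 1, by omega⟩ : Fin (2*n))
          else ⟨n, by omega⟩)).det
      * (X.submatrix (fun s : Fin (n-1) => (⟨(s : ℕ), by have := s.isLt; omega⟩ : Fin (2*n)))
        (fun s : Fin (n-1) => (⟨(s : ℕ), by have := s.isLt; omega⟩ : Fin (2*n)))).det
    = - ((X.submatrix (fun s : Fin (n-1) => (⟨(s : ℕ), by have := s.isLt; omega⟩ : Fin (2*n)))
        (fun s : Fin (n-1) =>
          if (s : ℕ) < n - 2 then (⟨(s : ℕ), by have := s.isLt; omega⟩ : Fin (2*n))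
          else ⟨n, by omega⟩)).det
      * (X.submatrix (fun s : Fin n => (⟨(s : ℕ), by have := s.isLt; omega⟩ : Fin (2*n)))
        (fun s : Fin n => (⟨(s : ℕ), by have := s.isLt; omega⟩ : Fin (2*n)))).det) := by
  obtain ⟨m, rfl⟩ := Nat.exists_eq_add_of_le' hn
  set N := X.submatrix (fun s : Fin (m + 2) => (⟨s, by omega⟩ : Fin (2 * (m + 2))))
    (fun s : Fin (m + 2) => if (s : ℕ) < m + 1 then (⟨s, by omega⟩ : Fin (2 * (m + 2)))
      else ⟨m + 2, by omega⟩) with hN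
  have hN0 : N.det = 0 := SOeven.det_submatrix_eq_zero m hX
  have key := cramer_mul_cramer_comm_of_det_eq_zero hN0
    (fun s => X ⟨s, by omega⟩ ⟨m + 1, by omega⟩) (Pi.single (Fin.last (m + 1)) 1)
    (Fin.last m).castSucc (Fin.last (m + 1))
  rw [cramer_single_one, cramer_single_one, cramer_apply, cramer_apply, Fin.val_last,
    Fin.val_castSucc, Fin.val_last, Fin.succAbove_last, Even.neg_one_pow ⟨_, rfl⟩,
    Odd.neg_one_pow ⟨m, by ring⟩, one_mul, neg_one_mul, mul_neg,
    mul_comm (det (updateCol N (Fin.last _) _))] at key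
  refine Eq.trans (congrArg₂ (· * ·) (congrArg det ?_) (congrArg det ?_)) (key.trans
    (congrArg Neg.neg (congrArg₂ (· * ·) (congrArg det ?_) (congrArg det ?_)).symm))
  · ext i j
    rw [updateCol_apply]
    simp only [hN, submatrix_apply, Fin.ext_iff, Fin.val_castSucc, Fin.val_last]
    have := j.isLt
    split_ifs <;> first | rfl | omega
  · ext i j
    simp only [hN, submatrix_apply, Fin.val_castSucc]
    rw [if_pos (by omega)]
  · ext i j
    simp only [hN, submatrix_apply, Fin.val_castSucc]
    have := j.isLt
    simp only [Fin.succAbove, Fin.lt_def, Fin.val_castSucc, Fin.val_last]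
    split_ifs <;> first | rfl | simp_all
  · ext i j
    rw [updateCol_apply]
    simp only [hN, submatrix_apply, Fin.ext_iff, Fin.val_last]
    have := j.isLt
    split_ifs with h
    · simp only [h]
    · rfl
    · omega
end
end

section
/- Let n ≥ 2. For every X ∈ SO(2n,ℂ) one has a_{-n,…,-3,-1,2}(X) = 0; that is, the determinant of the n×n submatrix of X with rows -n,…,-1 (the top n rows) and columns -n,…,-3,-1,2 vanishes. -/
open Matrix

noncomputable section

/-- Jacobi's complementary minor identity for the split form: the upper left block of an
isometry satisfies `det A = det M * det A`. -/
theorem Matrix.det_toBlocks₁₁_of_isometry {m R : Type*} [Fintype m] [DecidableEq m] [CommRing R]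
    (M : Matrix (m ⊕ m) (m ⊕ m) R)
    (hM : Mᵀ * fromBlocks 0 1 1 0 * M = fromBlocks 0 1 1 0) :
    M.toBlocks₁₁.det = M.det * M.toBlocks₁₁.det := by
  obtain ⟨A, B, C, D, rfl⟩ : ∃ A B C D, M = fromBlocks A B C D :=
    ⟨_, _, _, _, (fromBlocks_toBlocks M).symm⟩
  have hleft : (fromBlocks 0 1 1 0 * ((fromBlocks A B C D)ᵀ * fromBlocks 0 1 1 0)) *
      fromBlocks A B C D = 1 := by
    rw [Matrix.mul_assoc, hM]
    simp [fromBlocks_multiply]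
  have hright := mul_eq_one_comm.mp hleft
  simp only [fromBlocks_transpose, fromBlocks_multiply, ← fromBlocks_one] at hright
  obtain ⟨-, h₁₂, -, h₂₂⟩ := fromBlocks_inj.mp hright
  simp only [Matrix.zero_mul, Matrix.mul_zero, Matrix.one_mul, Matrix.mul_one, zero_add,
    add_zero] at h₁₂ h₂₂
  have hprod : fromBlocks A B C D * fromBlocks 1 Bᵀ 0 Aᵀ = fromBlocks A 0 C 1 := by
    simp [fromBlocks_multiply, h₁₂, h₂₂]
  have hdet := congrArg Matrix.det hprod
  rw [det_mul, det_fromBlocks_zero₂₁, det_fromBlocks_zero₁₂] at hdet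
  simpa using hdet.symm

/-- The labelling of the positions of `I_n` that sends `inl s` to `s` and `inr s` to its
reversal. -/
def splitEquiv (n : ℕ) : Fin n ⊕ Fin n ≃ Fin (2 * n) :=
  Equiv.ofBijective
    (Sum.elim (fun s => ⟨s, by omega⟩) (fun s => Fin.rev ⟨s, by omega⟩)) <| by
    rw [Fintype.bijective_iff_injective_and_card]
    refine ⟨?_, by simp [two_mul]⟩
    rintro (a | a) (b | b) h <;> simp [Fin.ext_iff, Fin.val_rev] at h ⊢ <;> omega

theorem splitEquiv_inl {n : ℕ} (s : Fin n) :
    splitEquiv n (Sum.inl s) = ⟨s, by omega⟩ := rfl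

theorem splitEquiv_inr {n : ℕ} (s : Fin n) :
    splitEquiv n (Sum.inr s) = Fin.rev ⟨s, by omega⟩ := rfl

theorem splitEquiv_swap {n : ℕ} (x : Fin n ⊕ Fin n) :
    splitEquiv n x.swap = (splitEquiv n x).rev := by
  cases x <;> simp [splitEquiv_inl, splitEquiv_inr]

theorem SmatE_submatrix_s9 {n : ℕ} (f : Fin n ⊕ Fin n ≃ Fin (2 * n))
    (hf : ∀ x, f x.swap = (f x).rev) :
    (SmatE n).submatrix f f = fromBlocks 0 1 1 0 := by
  ext x y
  simp only [SmatE, submatrix_apply, of_apply, ← hf, f.injective.eq_iff]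
  rcases x with a | a <;> rcases y with b | b <;> simp [one_apply, eq_comm]

/-- The four-cycle `inl a → inl b → inr a → inr b → inl a`. -/
def quarterTurn {m : Type*} [DecidableEq m] (a b : m) : Equiv.Perm (m ⊕ m) :=
  Equiv.swap (Sum.inl a) (Sum.inr a) * Equiv.Perm.sumCongr (Equiv.swap a b) (Equiv.swap a b)

theorem sign_quarterTurn {m : Type*} [Fintype m] [DecidableEq m] (a b : m) :
    Equiv.Perm.sign (quarterTurn a b) = -1 := by
  rw [quarterTurn, Equiv.Perm.sign_mul, Equiv.Perm.sign_sumCongr, Int.units_mul_self,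
    Equiv.Perm.sign_swap Sum.inl_ne_inr, mul_one]

theorem quarterTurn_swap {m : Type*} [DecidableEq m] (a b : m) (x : m ⊕ m) :
    quarterTurn a b x.swap = (quarterTurn a b x).swap := by
  rcases x with x | x <;>
    simp only [quarterTurn, Equiv.Perm.mul_apply, Sum.swap_inl, Sum.swap_inr,
      Equiv.Perm.sumCongr_apply, Sum.map_inl, Sum.map_inr, Equiv.swap_apply_def,
      Sum.inl.injEq, Sum.inr.injEq, reduceCtorEq, if_false] <;>
    split_ifs <;> simp_all

/-- For `X ∈ SO(2n,ℂ)`: `a_{-n,…,-3,-1,2}(X) = 0`, the `n × n` minor over the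
top `n` rows with columns `-n,…,-3,-1,2` (positions `0,…,n-3`, `n-1`, `n+1`). -/
theorem statement9 (n : ℕ) (hn : 2 ≤ n) (X : Matrix (Fin (2*n)) (Fin (2*n)) ℂ)
    (hX : X ∈ SOeven n) :
    (X.submatrix (fun s : Fin n => (⟨(s : ℕ), by have := s.isLt; omega⟩ : Fin (2*n)))
        (fun s : Fin n =>
          if (s : ℕ) < n - 2 then (⟨(s : ℕ), by have := s.isLt; omega⟩ : Fin (2*n))
          else if (s : ℕ) = n - 2 then (⟨n - 1, by omega⟩ : Fin (2*n))
          else ⟨n + 1, by omega⟩)).det = 0 := by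
  obtain ⟨hO, hdet⟩ := hX
  have hO : Xᵀ * SmatE n * X = SmatE n := hO
  set e := splitEquiv n
  set τ := quarterTurn (⟨n - 2, by omega⟩ : Fin n) ⟨n - 1, by omega⟩ with hτ
  have hswap : ∀ x, (τ.trans e) x.swap = ((τ.trans e) x).rev := fun x => by
    rw [Equiv.trans_apply, quarterTurn_swap, splitEquiv_swap, Equiv.trans_apply]
  set Y := X.submatrix e (τ.trans e) with hY
  have hYO : Yᵀ * fromBlocks 0 1 1 0 * Y = fromBlocks 0 1 1 0 := by
    rw [← SmatE_submatrix_s9 e splitEquiv_swap, hY, transpose_submatrix, submatrix_mul_equiv,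
      submatrix_mul_equiv, hO, SmatE_submatrix_s9 _ hswap, SmatE_submatrix_s9 e splitEquiv_swap]
  have hYdet : Y.det = -1 := by
    have h : Y = (X.submatrix e e).submatrix id τ := rfl
    rw [h, det_permute', det_submatrix_equiv_self, hdet, sign_quarterTurn]
    simp
  have hzero := Matrix.det_toBlocks₁₁_of_isometry Y hYO
  rw [hYdet, neg_one_mul, self_eq_neg] at hzero
  rw [← hzero]
  congr 1
  ext i s
  simp only [hY, toBlocks₁₁, submatrix_apply, of_apply, Equiv.trans_apply]
  congr 1
  have hs := s.isLt
  simp only [hτ, quarterTurn, Equiv.Perm.mul_apply, Equiv.Perm.sumCongr_apply, Sum.map_inl,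
    Equiv.swap_apply_def, Sum.inl.injEq, reduceCtorEq, if_false, Fin.ext_iff]
  split_ifs <;> simp [e, splitEquiv_inl, splitEquiv_inr, Fin.val_rev] at * <;> omega
end
end

section
/- Let n ≥ 2. For every X ∈ SO(2n,ℂ) one has a_{-n,…,-3,-2,2}(X) = a_{-n,…,-3,-1,1}(X); that is, the determinant of the n×n submatrix of X with rows -n,…,-1 (the top n rows) and columns -n,…,-3,-2,2 equals the determinant of the n×n submatrix with the same rows and columns -n,…,-3,-1,1. -/
open Matrix

noncomputable section

/-- Jacobi's complementary minor identity for the diagonal blocks of a matrix and its inverse. -/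
theorem det_mul_det_toBlocks₂₂_of_mul_eq_one {m k R : Type*} [Fintype m] [Fintype k]
    [DecidableEq m] [DecidableEq k] [CommRing R] {Y W : Matrix (m ⊕ k) (m ⊕ k) R}
    (h : Y * W = 1) : Y.det * W.toBlocks₂₂.det = Y.toBlocks₁₁.det := by
  have hYW := h
  rw [← fromBlocks_toBlocks Y, ← fromBlocks_toBlocks W, fromBlocks_multiply,
    ← fromBlocks_one, fromBlocks_inj] at hYW
  obtain ⟨-, h₁₂, -, h₂₂⟩ := hYW
  have key : Y * fromBlocks 1 W.toBlocks₁₂ 0 W.toBlocks₂₂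
      = fromBlocks Y.toBlocks₁₁ 0 Y.toBlocks₂₁ 1 := by
    conv_lhs => rw [← fromBlocks_toBlocks Y]
    rw [fromBlocks_multiply]
    simp [h₁₂, h₂₂]
  simpa using congrArg det key

/-- The inverse of `X ∈ O(2n,ℂ)` is the transpose of `X` about the antidiagonal. -/
theorem mul_transpose_submatrix_rev_of_mem_Oeven {n : ℕ}
    {X : Matrix (Fin (2*n)) (Fin (2*n)) ℂ} (hX : X ∈ Oeven n) :
    X * Xᵀ.submatrix Fin.rev Fin.rev = 1 := by
  have hrev (j k : Fin (2*n)) : j = k.rev ↔ k = j.rev := by rw [eq_comm, Fin.rev_eq_iff]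
  have hS : SmatE n * SmatE n = 1 := by
    ext i j
    simp [mul_apply, SmatE, one_apply, hrev j, eq_comm]
  have hXi : Xᵀ.submatrix Fin.rev Fin.rev = SmatE n * Xᵀ * SmatE n := by
    ext i j
    simp [mul_apply, SmatE, hrev j]
  have hO : Xᵀ * SmatE n * X = SmatE n := hX
  rw [hXi, mul_eq_one_comm, Matrix.mul_assoc, Matrix.mul_assoc, ← Matrix.mul_assoc Xᵀ, hO, hS]

/-- Two copies of `Fin n` cover `Fin (2 * n)`: the first in increasing order from the start,
the second in decreasing order from the end. -/
def sumRevEquiv (n : ℕ) : Fin n ⊕ Fin n ≃ Fin (2*n) :=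
  Equiv.ofBijective
    (Sum.elim (fun s => ⟨s, by omega⟩) (fun s => Fin.rev ⟨s, by omega⟩)) (by
      rw [Fintype.bijective_iff_injective_and_card]
      refine ⟨?_, by simp [two_mul]⟩
      rintro (a | a) (b | b) h <;> simp [Fin.ext_iff] at h ⊢ <;> omega)

/-- The value of `sumRevEquiv` on the first copy. -/
theorem sumRevEquiv_inl {n : ℕ} (s : Fin n) : sumRevEquiv n (Sum.inl s) = ⟨s, by omega⟩ := rfl

/-- The value of `sumRevEquiv` on the second copy. -/
theorem sumRevEquiv_inr {n : ℕ} (s : Fin n) :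
    sumRevEquiv n (Sum.inr s) = Fin.rev ⟨s, by omega⟩ := rfl

/-- Minors of `X ∈ SO(2n,ℂ)` over the top `n` rows agree when the column sets are complementary
up to negation and the resulting arrangement of all columns is an even permutation. -/
theorem det_submatrix_eq_of_mem_SOeven {n : ℕ} {X : Matrix (Fin (2*n)) (Fin (2*n)) ℂ}
    (hX : X ∈ SOeven n) {c d : Fin n → Fin (2*n)} (σ : Equiv.Perm (Fin n ⊕ Fin n))
    (hσ : Equiv.Perm.sign σ = 1) (hc : ∀ s, sumRevEquiv n (σ (Sum.inl s)) = c s)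
    (hd : ∀ s, sumRevEquiv n (σ (Sum.inr s)) = (d s).rev) :
    (X.submatrix (fun s : Fin n => (⟨s, by omega⟩ : Fin (2*n))) c).det
      = (X.submatrix (fun s : Fin n => (⟨s, by omega⟩ : Fin (2*n))) d).det := by
  set r := sumRevEquiv n
  have hYW : X.submatrix r (σ.trans r) *
      (Xᵀ.submatrix Fin.rev Fin.rev).submatrix (σ.trans r) r = 1 := by
    rw [submatrix_mul_equiv, mul_transpose_submatrix_rev_of_mem_Oeven hX.1, submatrix_one_equiv]
  have hY : (X.submatrix r (σ.trans r)).det = 1 := by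
    have h := det_permute' σ (X.submatrix r r)
    rw [hσ, det_submatrix_equiv_self, hX.2] at h
    simpa using h
  have h := det_mul_det_toBlocks₂₂_of_mul_eq_one hYW
  rw [hY, one_mul, ← det_transpose] at h
  convert h.symm using 2
  · ext s t
    simp [toBlocks₁₁, hc, r, sumRevEquiv_inl]
  · ext s t
    simp [toBlocks₂₂, hd, r, sumRevEquiv_inr]

/-- For `X ∈ SO(2n,ℂ)`: `a_{-n,…,-3,-2,2}(X) = a_{-n,…,-3,-1,1}(X)`,
both `n × n` minors over the top `n` rows, with columns `-n,…,-3,-2,2`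
(positions `0,…,n-2`, `n+1`) resp. columns `-n,…,-3,-1,1`
(positions `0,…,n-3`, `n-1`, `n`). -/
theorem statement10 (n : ℕ) (hn : 2 ≤ n) (X : Matrix (Fin (2*n)) (Fin (2*n)) ℂ)
    (hX : X ∈ SOeven n) :
    (X.submatrix (fun s : Fin n => (⟨(s : ℕ), by have := s.isLt; omega⟩ : Fin (2*n)))
        (fun s : Fin n =>
          if (s : ℕ) < n - 1 then (⟨(s : ℕ), by have := s.isLt; omega⟩ : Fin (2*n))
          else ⟨n + 1, by omega⟩)).det
    = (X.submatrix (fun s : Fin n => (⟨(s : ℕ), by have := s.isLt; omega⟩ : Fin (2*n)))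
        (fun s : Fin n =>
          if (s : ℕ) < n - 2 then (⟨(s : ℕ), by have := s.isLt; omega⟩ : Fin (2*n))
          else if (s : ℕ) = n - 2 then (⟨n - 1, by omega⟩ : Fin (2*n))
          else ⟨n, by omega⟩)).det := by
  have hab : (Sum.inl ⟨n - 1, by omega⟩ : Fin n ⊕ Fin n) ≠ Sum.inr ⟨n - 2, by omega⟩ := by simp
  have hbc : (Sum.inr ⟨n - 2, by omega⟩ : Fin n ⊕ Fin n) ≠ Sum.inr ⟨n - 1, by omega⟩ := by
    simp
    omega
  refine det_submatrix_eq_of_mem_SOeven hX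
    (Equiv.swap (Sum.inl ⟨n - 1, by omega⟩) (Sum.inr ⟨n - 2, by omega⟩) *
      Equiv.swap (Sum.inr ⟨n - 2, by omega⟩) (Sum.inr ⟨n - 1, by omega⟩)) ?_ ?_ ?_
  · simp [Equiv.Perm.sign_swap hab, Equiv.Perm.sign_swap hbc]
  · intro s
    have := s.isLt
    simp only [Equiv.Perm.mul_apply, Equiv.swap_apply_def, Sum.inl.injEq, reduceCtorEq,
      if_false, Fin.ext_iff]
    split_ifs <;> simp [sumRevEquiv_inl, sumRevEquiv_inr] <;> omega
  · intro s
    have := s.isLt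
    simp only [Equiv.Perm.mul_apply, Equiv.swap_apply_def, Sum.inr.injEq,
      Fin.ext_iff]
    split_ifs <;> simp_all [sumRevEquiv_inl, sumRevEquiv_inr, Fin.ext_iff] <;> omega
end
end

section
/- Let n ≥ 2. For every X ∈ SO(2n,ℂ) one has ā_{-n,…,-3,1,2}(X) = 0; that is, the determinant of the n×n submatrix of X with rows -n,…,-2,1 (the first n−1 rows together with row 1) and columns -n,…,-3,1,2 vanishes. -/
open Matrix

noncomputable section

/-- The split form preserved by `fromBlocks A B C D` forces determinant `1` as soon as the
upper left block is invertible. -/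
theorem det_fromBlocks_eq_one_of_preserves_split_form {m K : Type*} [Fintype m] [DecidableEq m]
    [Field K] (A B C D : Matrix m m K)
    (h : fromBlocks A B C D * fromBlocks 0 1 1 0 * (fromBlocks A B C D)ᵀ = fromBlocks 0 1 1 0)
    (hA : A.det ≠ 0) : (fromBlocks A B C D).det = 1 := by
  have hu : IsUnit A.det := isUnit_iff_ne_zero.mpr hA
  let _ : Invertible A := A.invertibleOfIsUnitDet hu
  simp only [fromBlocks_transpose, fromBlocks_multiply, Matrix.mul_zero, Matrix.mul_one, zero_add,
    add_zero, fromBlocks_inj] at h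
  obtain ⟨hskew, hdual, -, -⟩ := h
  have hB : Bᵀ = -(A⁻¹ * B * Aᵀ) := by
    have := congrArg (A⁻¹ * ·) hskew
    simp only [Matrix.mul_add, Matrix.mul_zero, ← Matrix.mul_assoc, Matrix.nonsing_inv_mul A hu,
      Matrix.one_mul] at this
    exact eq_neg_of_add_eq_zero_right this
  have hK : (A⁻¹ * B)ᵀ = -(A⁻¹ * B) := by
    rw [transpose_mul, hB, transpose_nonsing_inv, Matrix.neg_mul, Matrix.mul_assoc,
      Matrix.mul_nonsing_inv _ (by rwa [det_transpose]), Matrix.mul_one]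
  have hS : A * (D - C * (A⁻¹ * B))ᵀ = 1 := by
    rw [transpose_sub, transpose_mul, hK, Matrix.neg_mul, sub_neg_eq_add, Matrix.mul_add,
      ← Matrix.mul_assoc A, ← Matrix.mul_assoc A, Matrix.mul_nonsing_inv A hu, Matrix.one_mul,
      add_comm, hdual]
  rw [det_fromBlocks₁₁, invOf_eq_nonsing_inv, Matrix.mul_assoc, ← det_transpose (D - _), ← det_mul,
    hS, det_one]

/-- An isometry of the form `SmatE n` with a nonzero principal minor on a set of indices `r`
meeting each pair `{p, p.rev}` exactly once has determinant `1`. -/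
theorem det_eq_one_of_mem_Oeven_of_minor_ne_zero {n : ℕ} {Y : Matrix (Fin (2*n)) (Fin (2*n)) ℂ}
    (hY : Y ∈ Oeven n) {r : Fin n → Fin (2*n)} (hr : Function.Injective r)
    (hrev : ∀ s t, r s ≠ (r t).rev) (hminor : (Y.submatrix r r).det ≠ 0) : Y.det = 1 := by
  have hinj : Function.Injective (Sum.elim r (fun s => (r s).rev)) :=
    hr.sumElim (Fin.rev_injective.comp hr) hrev
  let e : Fin n ⊕ Fin n ≃ Fin (2*n) := Equiv.ofBijective _
    ((Fintype.bijective_iff_injective_and_card _).mpr ⟨hinj, by simp [two_mul]⟩)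
  have hel : ∀ s, e (Sum.inl s) = r s := fun _ => rfl
  have her : ∀ s, e (Sum.inr s) = (r s).rev := fun _ => rfl
  have hSe : (SmatE n).submatrix e e = fromBlocks 0 1 1 0 := by
    ext (i | i) (j | j) <;>
      simp [SmatE, hel, her, hrev, (hrev _ _).symm, Matrix.one_apply, hr.eq_iff, eq_comm]
  have hSS : SmatE n * SmatE n = 1 := by
    ext i j
    rw [Matrix.mul_apply, Finset.sum_eq_single i.rev]
    · simp [SmatE, Matrix.one_apply, eq_comm (a := j)]
    · intro k _ hk
      simp [SmatE, hk]
    · simp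
  have hYS : Y * SmatE n * Yᵀ = SmatE n := by
    have h1 : SmatE n * Yᵀ * SmatE n * Y = 1 := by
      rw [Matrix.mul_assoc (SmatE n), Matrix.mul_assoc (SmatE n), hY, hSS]
    have h2 := mul_eq_one_comm.mp h1
    calc Y * SmatE n * Yᵀ = Y * (SmatE n * Yᵀ * SmatE n) * SmatE n := by
          simp only [Matrix.mul_assoc, hSS, Matrix.mul_one]
      _ = SmatE n := by rw [h2, Matrix.one_mul]
  have hblock : Y.submatrix e e * fromBlocks 0 1 1 0 * (Y.submatrix e e)ᵀ = fromBlocks 0 1 1 0 := by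
    rw [← hSe, transpose_submatrix, submatrix_mul_equiv, submatrix_mul_equiv, hYS]
  rw [← det_submatrix_equiv_self e Y]
  rw [← fromBlocks_toBlocks (Y.submatrix e e)] at hblock ⊢
  exact det_fromBlocks_eq_one_of_preserves_split_form _ _ _ _ hblock hminor

/-- Permuting the columns by a permutation commuting with `Fin.rev` preserves `Oeven n`. -/
theorem submatrix_id_mem_Oeven {n : ℕ} {X : Matrix (Fin (2*n)) (Fin (2*n)) ℂ} (hX : X ∈ Oeven n)
    {σ : Equiv.Perm (Fin (2*n))} (hσ : ∀ p, σ p.rev = (σ p).rev) :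
    X.submatrix id σ ∈ Oeven n := by
  have hS : (SmatE n).submatrix σ σ = SmatE n := by
    ext p q
    simp [SmatE, ← hσ]
  have hX' : Xᵀ * SmatE n * X = SmatE n := hX
  change (X.submatrix id σ)ᵀ * SmatE n * X.submatrix id σ = SmatE n
  conv_rhs => rw [← hS, ← hX']
  rfl

/-- For `X ∈ SO(2n,ℂ)`: `ā_{-n,…,-3,1,2}(X) = 0`, the `n × n` minor over rows
`-n,…,-2,1` (positions `0,…,n-2` and `n`) with columns `-n,…,-3,1,2`
(positions `0,…,n-3`, `n`, `n+1`). -/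
theorem statement12 (n : ℕ) (hn : 2 ≤ n) (X : Matrix (Fin (2*n)) (Fin (2*n)) ℂ)
    (hX : X ∈ SOeven n) :
    (X.submatrix
        (fun s : Fin n =>
          if (s : ℕ) < n - 1 then (⟨(s : ℕ), by have := s.isLt; omega⟩ : Fin (2*n))
          else ⟨n, by omega⟩)
        (fun s : Fin n =>
          if (s : ℕ) < n - 2 then (⟨(s : ℕ), by have := s.isLt; omega⟩ : Fin (2*n))
          else if (s : ℕ) = n - 2 then (⟨n, by omega⟩ : Fin (2*n))
          else ⟨n + 1, by omega⟩)).det = 0 := by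
  by_contra hdet
  obtain ⟨hO, hX1⟩ := hX
  let a : Fin (2*n) := ⟨n - 2, by omega⟩
  let b : Fin (2*n) := ⟨n, by omega⟩
  let c : Fin (2*n) := ⟨n + 1, by omega⟩
  let d : Fin (2*n) := ⟨n - 1, by omega⟩
  let σ : Equiv.Perm (Fin (2*n)) := Equiv.swap a b * Equiv.swap b c * Equiv.swap c d
  have hab : a ≠ b := by simp [a, b, Fin.ext_iff]; omega
  have hbc : b ≠ c := by simp [b, c, Fin.ext_iff]
  have hcd : c ≠ d := by simp [c, d, Fin.ext_iff]; omega
  have hsign : Equiv.Perm.sign σ = -1 := by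
    simp [σ, hab, hbc, hcd]
  have hσval : ∀ p, (σ p : ℕ) = if (p : ℕ) = n - 2 then n else if (p : ℕ) = n then n + 1
      else if (p : ℕ) = n + 1 then n - 1 else if (p : ℕ) = n - 1 then n - 2 else p := by
    intro p
    simp only [σ, Equiv.Perm.mul_apply, Equiv.swap_apply_def, a, b, c, d, Fin.ext_iff]
    grind
  have hσ : ∀ p, σ p.rev = (σ p).rev := by
    intro p
    have := p.isLt
    rw [Fin.ext_iff, Fin.val_rev, hσval, hσval, Fin.val_rev]
    grind
  let r : Fin n → Fin (2*n) := fun s =>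
    if (s : ℕ) < n - 1 then ⟨(s : ℕ), by have := s.isLt; omega⟩ else ⟨n, by omega⟩
  have hrval : ∀ s, (r s : ℕ) = if (s : ℕ) < n - 1 then (s : ℕ) else n := by
    intro s
    simp only [r]
    split_ifs <;> rfl
  have hr : Function.Injective r := by
    intro s t hst
    have := s.isLt
    have := t.isLt
    rw [Fin.ext_iff, hrval, hrval] at hst
    rw [Fin.ext_iff]
    split_ifs at hst <;> omega
  have hrev : ∀ s t, r s ≠ (r t).rev := by
    intro s t hst
    rw [Fin.ext_iff, Fin.val_rev, hrval, hrval] at hst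
    split_ifs at hst <;> omega
  have hone : (X.submatrix id σ).det = 1 := by
    refine det_eq_one_of_mem_Oeven_of_minor_ne_zero (submatrix_id_mem_Oeven hO hσ) hr hrev ?_
    convert hdet using 2
    rw [submatrix_submatrix]
    congr 1
    funext s
    have := s.isLt
    rw [Fin.ext_iff, Function.comp_apply, hσval, hrval]
    grind
  rw [det_permute', hsign, hX1] at hone
  norm_num at hone
end
end

section
/- Let n ≥ 2. For every X ∈ SO(2n,ℂ) one has ā_{-n,…,-3,-1,1}(X) · a_{-n,…,-3,-2}(X) = a_{-n,…,-3,-1}(X) · ā_{-n,…,-3,-2,1}(X), where ā_{-n,…,-3,-1,1} and ā_{-n,…,-3,-2,1} are n×n minors over the rows -n,…,-2,1 (the first n−1 rows together with row 1) with column sets {-n,…,-3,-1,1} and {-n,…,-3,-2,1}, and a_{-n,…,-3,-2} and a_{-n,…,-3,-1} are (n−1)×(n−1) minors over the top n−1 rows (rows -n,…,-2) with column sets {-n,…,-3,-2} and {-n,…,-3,-1}. -/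
open Matrix

noncomputable section

/-- A matrix of determinant `-1` that is orthogonal for the split form `fromBlocks 0 1 1 0` has a
singular upper left block. -/
theorem det_toBlocks₁₁_eq_zero_of_split_orthogonal {m : Type*} [Fintype m] [DecidableEq m]
    (Y : Matrix (m ⊕ m) (m ⊕ m) ℂ)
    (hY : Y * fromBlocks 0 1 1 0 * Yᵀ = fromBlocks 0 1 1 0) (hdet : Y.det = -1) :
    Y.toBlocks₁₁.det = 0 := by
  obtain ⟨A, B, C, D, rfl⟩ : ∃ A B C D, Y = fromBlocks A B C D :=
    ⟨_, _, _, _, (fromBlocks_toBlocks Y).symm⟩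
  simp only [fromBlocks_transpose, fromBlocks_multiply, fromBlocks_inj, mul_zero, mul_one,
    zero_add, add_zero] at hY
  obtain ⟨h₁, -, h₃, -⟩ := hY
  have key : fromBlocks A B C D * fromBlocks 1 Bᵀ 0 Aᵀ = fromBlocks A 0 C 1 := by
    rw [fromBlocks_multiply, fromBlocks_inj]
    refine ⟨by simp, ?_, by simp, ?_⟩
    · rw [add_comm]; exact h₁
    · rw [add_comm]; exact h₃
  have h := congrArg det key
  rw [det_mul, hdet, det_fromBlocks_zero₂₁, det_fromBlocks_zero₁₂, det_transpose] at h
  simp only [det_one, one_mul, mul_one] at h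
  rw [toBlocks_fromBlocks₁₁]
  linear_combination (-1 / 2 : ℂ) * h

/-- The signed maximal minors of a matrix with one more column than rows form a vector in its
kernel. -/
theorem sum_neg_one_pow_mul_det_succAbove_eq_zero {R : Type*} [CommRing R] {m : ℕ}
    (M : Matrix (Fin m) (Fin (m + 1)) R) (i : Fin m) :
    ∑ j : Fin (m + 1), (-1) ^ (j : ℕ) * M i j * (M.submatrix id j.succAbove).det = 0 := by
  have h : (Matrix.of (Fin.cons (M i) M : Fin (m + 1) → Fin (m + 1) → R)).det = 0 :=
    det_zero_of_row_eq (i := 0) (j := i.succ) (Fin.succ_ne_zero i).symm rfl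
  rw [det_succ_row_zero] at h
  exact h

/-- A three-term Plücker relation between the minors of a matrix and those of the matrix with its
last row removed. -/
theorem det_mul_det_add_det_mul_det_eq {R : Type*} [CommRing R] {k : ℕ}
    (M : Matrix (Fin (k + 2)) (Fin (k + 3)) R) (N : Fin (k + 3) → R)
    (hN : N = fun j => ((M.submatrix Fin.castSucc fun s : Fin (k + 1) =>
      s.castSucc.castSucc).updateCol (Fin.last k) fun i => M i.castSucc j).det) :
    (M.submatrix id (Fin.last k).castSucc.castSucc.succAbove).det * N (Fin.last k).castSucc.castSucc
      + (M.submatrix id Fin.castSucc).det * N (Fin.last (k + 2))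
    = N (Fin.last (k + 1)).castSucc
      * (M.submatrix id (Fin.last (k + 1)).castSucc.succAbove).det := by
  have hker : (∑ j : Fin (k + 3), ((-1) ^ (j : ℕ) * (M.submatrix id j.succAbove).det) •
      fun i : Fin (k + 1) => M i.castSucc j) = 0 := by
    ext i
    rw [Finset.sum_apply, Pi.zero_apply,
      ← sum_neg_one_pow_mul_det_succAbove_eq_zero M i.castSucc]
    refine Finset.sum_congr rfl fun j _ => ?_
    simp only [Pi.smul_apply, smul_eq_mul]
    ring
  have hsum := congrFun (congrArg (cramer (M.submatrix Fin.castSucc fun s : Fin (k + 1) =>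
      s.castSucc.castSucc)) hker) (Fin.last k)
  have hzero : ∀ s : Fin k, N s.castSucc.castSucc.castSucc = 0 := by
    intro s
    rw [hN]
    refine det_zero_of_column_eq (i := s.castSucc) (j := Fin.last k) (Fin.castSucc_ne_last s) ?_
    intro i
    simp
  have hsum' : ∑ j : Fin (k + 3), (-1) ^ (j : ℕ) * (M.submatrix id j.succAbove).det * N j = 0 := by
    rw [map_sum, map_zero, Finset.sum_apply] at hsum
    simp only [map_smul] at hsum
    simpa only [Pi.smul_apply, cramer_apply, smul_eq_mul, Pi.zero_apply, hN] using hsum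
  rw [Fin.sum_univ_castSucc, Fin.sum_univ_castSucc, Fin.sum_univ_castSucc] at hsum'
  simp only [hzero, mul_zero, Finset.sum_const_zero, zero_add, Fin.val_castSucc, Fin.val_last,
    Fin.succAbove_last] at hsum'
  have hsq : ((-1 : R) ^ k) * (-1) ^ k = 1 := by rw [← mul_pow]; simp
  linear_combination (-1) ^ k * hsum' + (N (Fin.last (k + 1)).castSucc
      * (M.submatrix id (Fin.last (k + 1)).castSucc.succAbove).det
    - (M.submatrix id (Fin.last k).castSucc.castSucc.succAbove).det * N (Fin.last k).castSucc.castSucc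
    - (M.submatrix id Fin.castSucc).det * N (Fin.last (k + 2))) * hsq

theorem SmatE_mul_self (n : ℕ) : SmatE n * SmatE n = 1 := by
  ext i j
  simp [SmatE, mul_apply, one_apply, eq_comm (a := j), Fin.rev_eq_iff]

theorem mul_SmatE_mul_transpose {n : ℕ} {X : Matrix (Fin (2 * n)) (Fin (2 * n)) ℂ}
    (hX : X ∈ Oeven n) : X * SmatE n * Xᵀ = SmatE n := by
  have h : Xᵀ * SmatE n * X = SmatE n := hX
  have h₁ : (SmatE n * Xᵀ * SmatE n) * X = 1 := by
    rw [mul_assoc, mul_assoc, ← mul_assoc Xᵀ, h, SmatE_mul_self]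
  have h₂ := mul_eq_one_comm.mp h₁
  calc X * SmatE n * Xᵀ = X * (SmatE n * Xᵀ * SmatE n) * SmatE n := by
        simp only [mul_assoc, SmatE_mul_self, mul_one]
    _ = SmatE n := by rw [h₂, one_mul]

/-- The splitting of `2n` positions into the first `n` and, in reversed order, the last `n`. -/
def sumEquivFinTwoMul (n : ℕ) : Fin n ⊕ Fin n ≃ Fin (2 * n) :=
  (Equiv.sumCongr (Equiv.refl _) Fin.revPerm).trans
    (finSumFinEquiv.trans (finCongr (two_mul n).symm))

theorem sumEquivFinTwoMul_inl_val {n : ℕ} (i : Fin n) :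
    (sumEquivFinTwoMul n (Sum.inl i) : ℕ) = i := by
  simp [sumEquivFinTwoMul]

theorem sumEquivFinTwoMul_inr {n : ℕ} (i : Fin n) :
    sumEquivFinTwoMul n (Sum.inr i) = (sumEquivFinTwoMul n (Sum.inl i)).rev := by
  ext
  simp [sumEquivFinTwoMul, Fin.val_rev]
  omega

theorem SmatE_submatrix_sumEquivFinTwoMul (n : ℕ) :
    (SmatE n).submatrix (sumEquivFinTwoMul n) (sumEquivFinTwoMul n) = fromBlocks 0 1 1 0 := by
  have hinl : ∀ i j : Fin n, sumEquivFinTwoMul n (Sum.inl i) ≠ sumEquivFinTwoMul n (Sum.inr j) :=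
    fun i j h => by simpa using (sumEquivFinTwoMul n).injective h
  ext (i | i) (j | j)
  · simp [SmatE, ← sumEquivFinTwoMul_inr]
  · simp [SmatE, ← sumEquivFinTwoMul_inr, one_apply, eq_comm]
  · simp [SmatE, sumEquivFinTwoMul_inr, one_apply, eq_comm]
  · simp [SmatE, sumEquivFinTwoMul_inr i, Fin.rev_rev, (hinl i j).symm]

/-- The minor of `X ∈ SO(2n,ℂ)` on the first `n` columns and the first `n - 1` rows together with
row `1` vanishes. -/
theorem det_submatrix_eq_zero_of_mem_SOeven {n : ℕ} (hn : 2 ≤ n)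
    {X : Matrix (Fin (2 * n)) (Fin (2 * n)) ℂ}
    (hX : X ∈ SOeven n)
    (r c : Fin n → Fin (2 * n)) (hr : ∀ s, (r s : ℕ) = if (s : ℕ) < n - 1 then (s : ℕ) else n)
    (hc : ∀ s, (c s : ℕ) = s) : (X.submatrix r c).det = 0 := by
  set a : Fin (2 * n) := ⟨n - 1, by omega⟩ with ha
  set b : Fin (2 * n) := ⟨n, by omega⟩ with hb
  have hab : a ≠ b := by simp [ha, hb, Fin.ext_iff]; omega
  have hS : (SmatE n).submatrix (Equiv.swap a b) (Equiv.swap a b) = SmatE n := by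
    ext i j
    have hrev : (Equiv.swap a b i).rev = Equiv.swap a b i.rev := by
      simp only [Equiv.swap_apply_def, ha, hb, Fin.ext_iff]
      split_ifs <;> simp only [Fin.val_rev] at * <;> omega
    simp [SmatE, hrev]
  set e := sumEquivFinTwoMul n
  set Y := (X.submatrix (Equiv.swap a b) id).submatrix e e with hYdef
  have hY : Y * fromBlocks 0 1 1 0 * Yᵀ = fromBlocks 0 1 1 0 := by
    rw [← SmatE_submatrix_sumEquivFinTwoMul, hYdef, transpose_submatrix, submatrix_mul_equiv,
      submatrix_mul_equiv]
    congr 1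
    conv_rhs => rw [← hS, ← mul_SmatE_mul_transpose hX.1]
    ext i j
    simp [mul_apply]
  have hdet : Y.det = -1 := by
    rw [hYdef, det_submatrix_equiv_self, det_permute, Equiv.Perm.sign_swap hab, hX.2]
    simp
  rw [← det_toBlocks₁₁_eq_zero_of_split_orthogonal Y hY hdet]
  congr 1
  ext i j
  have hrow : Equiv.swap a b (e (Sum.inl i)) = r i := by
    have := sumEquivFinTwoMul_inl_val i
    have := hr i
    simp only [Equiv.swap_apply_def, ha, hb, Fin.ext_iff, e]
    split_ifs at * <;> first | omega | (simp only at *; omega)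
  have hcol : e (Sum.inl j) = c j := Fin.ext ((sumEquivFinTwoMul_inl_val j).trans (hc j).symm)
  simp [Y, toBlocks₁₁, hrow, hcol]

/-- For `X ∈ SO(2n,ℂ)`:
`ā_{-n,…,-3,-1,1}(X) · a_{-n,…,-3,-2}(X) = a_{-n,…,-3,-1}(X) · ā_{-n,…,-3,-2,1}(X)`.
Here `ā_{-n,…,-3,-1,1}` and `ā_{-n,…,-3,-2,1}` are `n × n` minors over rows
`-n,…,-2,1` (positions `0,…,n-2`, `n`) with columns at positions
`0,…,n-3, n-1, n` resp. `0,…,n-2, n`, and `a_{-n,…,-3,-2}`, `a_{-n,…,-3,-1}`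
are `(n-1) × (n-1)` minors over the top `n-1` rows with columns at positions
`0,…,n-2` resp. `0,…,n-3, n-1`. -/
theorem statement14 (n : ℕ) (hn : 2 ≤ n) (X : Matrix (Fin (2*n)) (Fin (2*n)) ℂ)
    (hX : X ∈ SOeven n) :
    (X.submatrix
        (fun s : Fin n =>
          if (s : ℕ) < n - 1 then (⟨(s : ℕ), by have := s.isLt; omega⟩ : Fin (2*n))
          else ⟨n, by omega⟩)
        (fun s : Fin n =>
          if (s : ℕ) < n - 2 then (⟨(s : ℕ), by have := s.isLt; omega⟩ : Fin (2*n))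
          else if (s : ℕ) = n - 2 then (⟨n - 1, by omega⟩ : Fin (2*n))
          else ⟨n, by omega⟩)).det
      * (X.submatrix (fun s : Fin (n-1) => (⟨(s : ℕ), by have := s.isLt; omega⟩ : Fin (2*n)))
        (fun s : Fin (n-1) => (⟨(s : ℕ), by have := s.isLt; omega⟩ : Fin (2*n)))).det
    = (X.submatrix (fun s : Fin (n-1) => (⟨(s : ℕ), by have := s.isLt; omega⟩ : Fin (2*n)))
        (fun s : Fin (n-1) =>
          if (s : ℕ) < n - 2 then (⟨(s : ℕ), by have := s.isLt; omega⟩ : Fin (2*n))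
          else ⟨n - 1, by omega⟩)).det
      * (X.submatrix
        (fun s : Fin n =>
          if (s : ℕ) < n - 1 then (⟨(s : ℕ), by have := s.isLt; omega⟩ : Fin (2*n))
          else ⟨n, by omega⟩)
        (fun s : Fin n =>
          if (s : ℕ) < n - 1 then (⟨(s : ℕ), by have := s.isLt; omega⟩ : Fin (2*n))
          else ⟨n, by omega⟩)).det := by
  obtain ⟨k, rfl⟩ : ∃ k, n = k + 2 := ⟨n - 2, by omega⟩
  have hrel := det_mul_det_add_det_mul_det_eq (X.submatrix
    (fun s : Fin (k + 2) => if (s : ℕ) < k + 2 - 1 then (⟨s, by omega⟩ : Fin (2 * (k + 2)))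
      else ⟨k + 2, by omega⟩)
    (fun s : Fin (k + 3) => (⟨s, by omega⟩ : Fin (2 * (k + 2))))) _ rfl
  simp only [submatrix_submatrix, Function.comp_def, Fin.val_castSucc, id] at hrel
  rw [det_submatrix_eq_zero_of_mem_SOeven hn hX _ (fun s => ⟨s, by omega⟩)
    (fun s => by split_ifs <;> rfl) fun _ => rfl, zero_mul, add_zero] at hrel
  have hentry : ∀ a b c d : Fin (2 * (k + 2)), (a : ℕ) = c → (b : ℕ) = d → X a b = X c d :=
    fun a b c d hac hbd => by rw [Fin.ext hac, Fin.ext hbd]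
  refine (congrArg₂ (· * ·) (congrArg det ?_)
    (congrArg (det : Matrix (Fin (k + 1)) (Fin (k + 1)) ℂ → ℂ) ?_)).trans (hrel.trans
    (congrArg₂ (· * ·) (congrArg (det : Matrix (Fin (k + 1)) (Fin (k + 1)) ℂ → ℂ)
    (Eq.symm ?_)) (congrArg det (Eq.symm ?_))))
  · ext i j
    refine hentry _ _ _ _ rfl ?_
    simp only [Fin.succAbove, Fin.lt_def, apply_ite Fin.val, Fin.val_castSucc, Fin.val_succ,
      Fin.val_last]
    split_ifs <;> omega
  · ext (i : Fin (k + 1)) (j : Fin (k + 1))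
    rw [updateCol_apply]
    split_ifs with hj
    · subst hj
      exact hentry _ _ _ _ (by simp [Fin.is_le]) (by simp)
    · exact hentry _ _ _ _ (by simp [Fin.is_le]) (by simp)
  · ext (i : Fin (k + 1)) (j : Fin (k + 1))
    rw [updateCol_apply]
    split_ifs with hj
    · subst hj
      exact hentry _ _ _ _ (by simp [Fin.is_le]) (by simp)
    · have hjk : (j : ℕ) < k := Fin.val_lt_last hj
      exact hentry _ _ _ _ (by simp [Fin.is_le]) (by simp [hjk])
  · ext i j
    refine hentry _ _ _ _ rfl ?_
    simp only [Fin.succAbove, Fin.lt_def, apply_ite Fin.val, Fin.val_castSucc, Fin.val_succ,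
      Fin.val_last]
    split_ifs <;> omega
end
end

section
/- (Grassmann–Plücker relation.) Let R be a commutative ring, k ≥ 1, and M a matrix over R with k rows and columns indexed by an arbitrary set. For any column indices c_1,…,c_{k-1} and d_0,d_1,…,d_k (not necessarily distinct), one has Σ_{t=0}^{k} (−1)^t · det M[c_1,…,c_{k-1},d_t] · det M[d_0,…,d_{t-1},d_{t+1},…,d_k] = 0, where M[e_1,…,e_k] denotes the k×k matrix whose s-th column is the column of M with index e_s. -/
open Matrix

/-- Cramer-type syzygy: the signed maximal minors of a `k × (k + 1)` matrix are orthogonal to each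
of its rows. -/
theorem Matrix.sum_neg_one_pow_mul_apply_mul_det_succAbove {R : Type*} [CommRing R] {k : ℕ}
    (A : Matrix (Fin k) (Fin (k + 1)) R) (i : Fin k) :
    ∑ t : Fin (k + 1), (-1 : R) ^ (t : ℕ) * A i t * (A.submatrix id t.succAbove).det = 0 := by
  let B : Matrix (Fin (k + 1)) (Fin (k + 1)) R := Matrix.of (Fin.cons (A i) A)
  have hB : B.det = 0 :=
    Matrix.det_zero_of_row_eq (Fin.succ_ne_zero i).symm rfl
  rw [Matrix.det_succ_row_zero] at hB
  exact hB

/-- Laplace expansion along the last column, when that column is the only one that varies. -/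
theorem Matrix.exists_det_submatrix_last_eq_sum {R : Type*} [CommRing R] {β : Type*} {n : ℕ}
    (M : Matrix (Fin (n + 1)) β R) (c : Fin n → β) :
    ∃ w : Fin (n + 1) → R, ∀ b : β,
      (M.submatrix id (fun s : Fin (n + 1) =>
        if h : (s : ℕ) < n then c ⟨(s : ℕ), h⟩ else b)).det = ∑ i, w i * M i b := by
  refine ⟨fun i => (-1) ^ (i + n : ℕ) * (M.submatrix i.succAbove c).det, fun b => ?_⟩
  rw [Matrix.det_succ_column _ (Fin.last n)]
  refine Finset.sum_congr rfl fun i _ => ?_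
  have hc : (M.submatrix id (fun s : Fin (n + 1) =>
      if h : (s : ℕ) < n then c ⟨(s : ℕ), h⟩ else b)).submatrix i.succAbove
        (Fin.last n).succAbove = M.submatrix i.succAbove c := by
    ext r s
    simp
  rw [hc]
  simp [mul_right_comm]

/-- Grassmann–Plücker relation: for a matrix `M` with `k` rows over a
commutative ring, column indices `c 0, …, c (k-2)` and `d 0, …, d k`
(repetitions allowed),
`Σ_{t=0}^{k} (−1)^t · det M[c₁,…,c_{k-1},d_t] · det M[d₀,…,d̂_t,…,d_k] = 0`,
where `M[e₁,…,e_k]` is the `k × k` matrix whose `s`-th column is the column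
of `M` with index `e_s`. -/
theorem statement15 {R : Type*} [CommRing R] {β : Type*} (k : ℕ) (hk : 1 ≤ k)
    (M : Matrix (Fin k) β R) (c : Fin (k-1) → β) (d : Fin (k+1) → β) :
    ∑ t : Fin (k+1), (-1 : R) ^ (t : ℕ)
      * (M.submatrix id (fun s : Fin k =>
          if h : (s : ℕ) < k - 1 then c ⟨(s : ℕ), h⟩ else d t)).det
      * (M.submatrix id (fun s : Fin k => d (t.succAbove s))).det = 0 := by
  obtain ⟨n, rfl⟩ : ∃ n, k = n + 1 := ⟨k - 1, by omega⟩
  obtain ⟨w, hw⟩ := M.exists_det_submatrix_last_eq_sum c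
  calc
    _ = ∑ t : Fin (n + 1 + 1), (-1 : R) ^ (t : ℕ) * (∑ i, w i * M i (d t))
          * (M.submatrix id (fun s : Fin (n + 1) => d (t.succAbove s))).det :=
      Finset.sum_congr rfl fun t _ => congrArg (fun x => (-1 : R) ^ (t : ℕ) * x * _) (hw (d t))
    _ = ∑ i, w i * ∑ t : Fin (n + 1 + 1), (-1 : R) ^ (t : ℕ) * M.submatrix id d i t
          * ((M.submatrix id d).submatrix id t.succAbove).det := by
      simp only [Finset.mul_sum, Finset.sum_mul]
      rw [Finset.sum_comm]
      refine Finset.sum_congr rfl fun i _ => Finset.sum_congr rfl fun t _ => ?_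
      simp only [Matrix.submatrix_apply, Matrix.submatrix_submatrix, Function.id_comp, id_eq]
      rw [Function.comp_def d]
      ring
    _ = 0 := by simp only [Matrix.sum_neg_one_pow_mul_apply_mul_det_succAbove, mul_zero,
        Finset.sum_const_zero]
end
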